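/- arXiv:1512.04679 — 10 statements merged into one kernel-verified Lean document; each statement's English description precedes it below -/
import Mathlib

section
/- Let u, v ∈ ℝ⁴ be linearly independent, let E = span{u, v}, and suppose E is nondegenerate. Suppose there exist two linearly independent vectors (a,b,c), (a',b',c') ∈ ℚ³ with a·G23 + b·G24 + c·G34 = 0 and a'·G23 + b'·G24 + c'·G34 = 0 (two subperiods of type 1), and two linearly independent vectors (d,e,f), (d',e',f') ∈ ℚ³ with d·G13 + e·G34 + f·G14 = 0 and d'·G13 + e'·G34 + f'·G14 = 0 (two subperiods of type 2). Then E is spanned by two vectors all of whose coordinates are rational. -/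
/-- Linearly independent vectors of `K³` have a nonzero `2 × 2` minor. -/
lemma minor_ne_zero_of_linearIndependent {K : Type*} [Field K] {a b c a' b' c' : K}
    (h : LinearIndependent K ![(![a, b, c] : Fin 3 → K), ![a', b', c']]) :
    ¬ (a * b' - a' * b = 0 ∧ b * c' - b' * c = 0 ∧ c * a' - c' * a = 0) := by
  rintro ⟨hab, hbc, hca⟩
  rw [LinearIndependent.pair_iff] at h
  have key (s t : K) (ha : s * a + t * a' = 0) (hb : s * b + t * b' = 0)
      (hc : s * c + t * c' = 0) : s = 0 ∧ t = 0 := by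
    refine h s t ?_
    ext i
    fin_cases i <;> simpa
  have ha : a = 0 := by
    simpa using (key a' (-a) (by ring) (by linear_combination -hab) (by linear_combination hca)).2
  have hb : b = 0 := by
    simpa using (key b' (-b) (by linear_combination hab) (by ring) (by linear_combination -hbc)).2
  have hc : c = 0 := by
    simpa using (key c' (-c) (by linear_combination -hca) (by linear_combination hbc) (by ring)).2
  exact one_ne_zero (key 1 0 (by simp [ha]) (by simp [hb]) (by simp [hc])).1

/-- Two independent rational relations among `x`, `y` and `z ≠ 0` make `x / z` and `y / z`
rational. -/
lemma exists_rat_div_eq_of_two_relations {a b c a' b' c' : ℚ} {x y z : ℝ} (hz : z ≠ 0)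
    (hminor : ¬ (a * b' - a' * b = 0 ∧ b * c' - b' * c = 0 ∧ c * a' - c' * a = 0))
    (h : a * x + b * y + c * z = 0) (h' : a' * x + b' * y + c' * z = 0) :
    (∃ q : ℚ, x / z = q) ∧ ∃ r : ℚ, y / z = r := by
  have hx : ((a * b' - a' * b : ℚ) : ℝ) * x = ((b * c' - b' * c : ℚ) : ℝ) * z := by
    push_cast
    linear_combination b' * h - b * h'
  have hy : ((a * b' - a' * b : ℚ) : ℝ) * y = ((c * a' - c' * a : ℚ) : ℝ) * z := by
    push_cast
    linear_combination a * h' - a' * h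
  have hD : a * b' - a' * b ≠ 0 := by
    intro hD
    rw [hD, Rat.cast_zero, zero_mul, eq_comm, mul_eq_zero, or_iff_left hz, Rat.cast_eq_zero]
      at hx hy
    exact hminor ⟨hD, hx, hy⟩
  have hD' : ((a * b' - a' * b : ℚ) : ℝ) ≠ 0 := Rat.cast_ne_zero.mpr hD
  refine ⟨⟨(b * c' - b' * c) / (a * b' - a' * b), ?_⟩,
    ⟨(c * a' - c' * a) / (a * b' - a' * b), ?_⟩⟩
  · rw [Rat.cast_div, div_eq_div_iff hz hD', ← hx, mul_comm]
  · rw [Rat.cast_div, div_eq_div_iff hz hD', ← hy, mul_comm]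


/-- A nondegenerate plane `E = span{u, v} ⊂ ℝ⁴` with two (linearly
independent) subperiods of type 1 and two of type 2 is spanned by two vectors
with rational coordinates. Indices: `G i j = u i * v j - u j * v i` with
`0,1,2,3` playing the roles of `1,2,3,4`. -/
theorem stmt_0 (u v : Fin 4 → ℝ)
    (hindep : LinearIndependent ℝ ![u, v])
    (G : Fin 4 → Fin 4 → ℝ)
    (hG : ∀ i j, G i j = u i * v j - u j * v i)
    (hnondeg : G 0 1 ≠ 0 ∧ G 0 2 ≠ 0 ∧ G 0 3 ≠ 0 ∧ G 1 2 ≠ 0 ∧ G 1 3 ≠ 0 ∧ G 2 3 ≠ 0)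
    (a b c a' b' c' : ℚ)
    (h1indep : LinearIndependent ℚ ![(![a, b, c] : Fin 3 → ℚ), ![a', b', c']])
    (h1 : (a : ℝ) * G 1 2 + (b : ℝ) * G 1 3 + (c : ℝ) * G 2 3 = 0)
    (h1' : (a' : ℝ) * G 1 2 + (b' : ℝ) * G 1 3 + (c' : ℝ) * G 2 3 = 0)
    (d e f d' e' f' : ℚ)
    (h2indep : LinearIndependent ℚ ![(![d, e, f] : Fin 3 → ℚ), ![d', e', f']])
    (h2 : (d : ℝ) * G 0 2 + (e : ℝ) * G 2 3 + (f : ℝ) * G 0 3 = 0)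
    (h2' : (d' : ℝ) * G 0 2 + (e' : ℝ) * G 2 3 + (f' : ℝ) * G 0 3 = 0) :
    ∃ w₁ w₂ : Fin 4 → ℝ, (∀ i, ∃ q : ℚ, w₁ i = (q : ℝ)) ∧ (∀ i, ∃ q : ℚ, w₂ i = (q : ℝ)) ∧
      Submodule.span ℝ ({u, v} : Set (Fin 4 → ℝ)) =
        Submodule.span ℝ ({w₁, w₂} : Set (Fin 4 → ℝ)) := by
  obtain ⟨-, -, -, -, -, hz⟩ := hnondeg
  obtain ⟨⟨q12, h12⟩, q13, h13⟩ :=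
    exists_rat_div_eq_of_two_relations hz (minor_ne_zero_of_linearIndependent h1indep) h1 h1'
  obtain ⟨⟨q02, h02⟩, q03, h03⟩ :=
    exists_rat_div_eq_of_two_relations (a := d) (b := f) (c := e) (a' := d') (b' := f') (c' := e')
      (x := G 0 2) (y := G 0 3) hz
      (fun ⟨hdf, hfe, hed⟩ ↦ minor_ne_zero_of_linearIndependent h2indep
        ⟨by linear_combination -hed, by linear_combination -hfe, by linear_combination -hdf⟩)
      (by linear_combination h2) (by linear_combination h2')
  rw [div_eq_iff hz] at h12 h13 h02 h03
  simp only [hG] at hz h12 h13 h02 h03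
  refine ⟨![q03, q13, 1, 0], ![-q02, -q12, 0, 1], ?_, ?_, ?_⟩
  · intro i
    refine ⟨![q03, q13, 1, 0] i, ?_⟩
    fin_cases i <;> simp
  · intro i
    refine ⟨![-q02, -q12, 0, 1] i, ?_⟩
    fin_cases i <;> simp
  apply le_antisymm <;> rw [Submodule.span_le, Set.insert_subset_iff, Set.singleton_subset_iff] <;>
    simp only [SetLike.mem_coe, Submodule.mem_span_pair]
  · refine ⟨⟨u 2, u 3, ?_⟩, v 2, v 3, ?_⟩ <;> ext i <;> fin_cases i <;> simp <;>
      apply mul_right_cancel₀ hz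
    · linear_combination u 3 * h02 - u 2 * h03
    · linear_combination u 3 * h12 - u 2 * h13
    · linear_combination v 3 * h02 - v 2 * h03
    · linear_combination v 3 * h12 - v 2 * h13
  · obtain ⟨t, ht⟩ : ∃ t, t * (u 2 * v 3 - u 3 * v 2) = 1 := ⟨_, inv_mul_cancel₀ hz⟩
    refine ⟨⟨t * v 3, -(t * u 3), ?_⟩, -(t * v 2), t * u 2, ?_⟩ <;> ext i <;>
      fin_cases i <;> simp
    · linear_combination t * h03 + q03 * ht
    · linear_combination t * h13 + q13 * ht
    · linear_combination ht
    · ring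
    · linear_combination -t * h02 - q02 * ht
    · linear_combination -t * h12 - q12 * ht
    · ring
    · linear_combination ht
end

section
/- Let u, v ∈ ℝ⁴ be linearly independent, let E = span{u, v}, and suppose E is nondegenerate and irrational. Suppose (a,b,c), (d,e,f), (g,h,i) ∈ ℚ³ are each nonzero and satisfy a·G23 + b·G24 + c·G34 = 0 (a subperiod of type 1), d·G13 + e·G34 + f·G14 = 0 (a subperiod of type 2), and g·G12 + h·G14 + i·G24 = 0 (a subperiod of type 3). Then the three corresponding coefficient vectors in ℚ⁶ (recording the coefficients of each linear form on the six Grassmann coordinates G12, G13, G14, G23, G24, G34) are linearly independent. -/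
/-- for a nondegenerate irrational plane `span{u, v} ⊂ ℝ⁴`, three
subperiods of types 1, 2 and 3 have linearly independent coefficient vectors in
`ℚ⁶` (coordinates ordered as `G12, G13, G14, G23, G24, G34`, i.e. in Lean
`G 0 1, G 0 2, G 0 3, G 1 2, G 1 3, G 2 3`). -/
theorem stmt_1 (u v : Fin 4 → ℝ)
    (hindep : LinearIndependent ℝ ![u, v])
    (G : Fin 4 → Fin 4 → ℝ)
    (hG : ∀ i j, G i j = u i * v j - u j * v i)
    (hnondeg : G 0 1 ≠ 0 ∧ G 0 2 ≠ 0 ∧ G 0 3 ≠ 0 ∧ G 1 2 ≠ 0 ∧ G 1 3 ≠ 0 ∧ G 2 3 ≠ 0)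
    (hirr : ∀ w : Fin 4 → ℝ, w ∈ Submodule.span ℝ ({u, v} : Set (Fin 4 → ℝ)) →
      (∀ i, ∃ q : ℚ, w i = (q : ℝ)) → w = 0)
    (a b c d e f g h i : ℚ)
    (h1ne : (a, b, c) ≠ (0, 0, 0))
    (h2ne : (d, e, f) ≠ (0, 0, 0))
    (h3ne : (g, h, i) ≠ (0, 0, 0))
    (h1 : (a : ℝ) * G 1 2 + (b : ℝ) * G 1 3 + (c : ℝ) * G 2 3 = 0)
    (h2 : (d : ℝ) * G 0 2 + (e : ℝ) * G 2 3 + (f : ℝ) * G 0 3 = 0)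
    (h3 : (g : ℝ) * G 0 1 + (h : ℝ) * G 0 3 + (i : ℝ) * G 1 3 = 0) :
    LinearIndependent ℚ
      ![(![0, 0, 0, a, b, c] : Fin 6 → ℚ),
        ![0, d, f, 0, 0, e],
        ![g, 0, h, 0, i, 0]] := by
  obtain ⟨-, -, h03, -, h13, h23⟩ := hnondeg
  -- A term `p * x` that vanishes with `x ≠ 0` forces the rational coefficient `p` to vanish.
  have coeff_eq_zero : ∀ {p : ℚ} {x : ℝ}, x ≠ 0 → (p : ℝ) * x = 0 → p = 0 := by
    intro p x hx hp
    exact_mod_cast (mul_eq_zero.mp hp).resolve_right hx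
  -- The vector `(G 0 3, G 1 3, G 2 3, 0) / G 2 3` lies in the plane.
  have not_rational : ∀ p q : ℚ, G 0 3 = p * G 2 3 → G 1 3 = q * G 2 3 → False := by
    intro p q hp hq
    have hw := hirr ((v 3 / G 2 3) • u + (-(u 3) / G 2 3) • v)
      (Submodule.mem_span_pair.mpr ⟨_, _, rfl⟩) ?_
    · have hw2 := congrFun hw 2
      simp only [Pi.add_apply, Pi.smul_apply, smul_eq_mul, Pi.zero_apply] at hw2
      field_simp at hw2
      exact h23 (by rw [hG]; linarith)
    · have hval : ∀ j, ((v 3 / G 2 3) • u + (-(u 3) / G 2 3) • v) j = G j 3 / G 2 3 := by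
        intro j
        simp only [Pi.add_apply, Pi.smul_apply, smul_eq_mul]
        rw [hG j 3]
        ring
      intro j
      rw [hval]
      fin_cases j
      · exact ⟨p, (div_eq_iff h23).mpr hp⟩
      · exact ⟨q, (div_eq_iff h23).mpr hq⟩
      · exact ⟨1, by simpa using div_self h23⟩
      · exact ⟨0, by simp [hG 3 3]⟩
  have not_a_zero_and_b_zero : a = 0 → b = 0 → False := by
    rintro rfl rfl
    have hc : c = 0 := coeff_eq_zero h23 (by simpa using h1)
    simp [hc] at h1ne
  have not_a_zero_and_c_zero : a = 0 → c = 0 → False := by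
    rintro rfl rfl
    have hb : b = 0 := coeff_eq_zero h13 (by simpa using h1)
    simp [hb] at h1ne
  have not_d_zero_and_e_zero : d = 0 → e = 0 → False := by
    rintro rfl rfl
    have hf : f = 0 := coeff_eq_zero h03 (by simpa using h2)
    simp [hf] at h2ne
  have not_d_zero_and_f_zero : d = 0 → f = 0 → False := by
    rintro rfl rfl
    have he : e = 0 := coeff_eq_zero h23 (by simpa using h2)
    simp [he] at h2ne
  have not_g_zero_and_h_zero : g = 0 → h = 0 → False := by
    rintro rfl rfl
    have hi : i = 0 := coeff_eq_zero h13 (by simpa using h3)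
    simp [hi] at h3ne
  have not_g_zero_and_i_zero : g = 0 → i = 0 → False := by
    rintro rfl rfl
    have hh : h = 0 := coeff_eq_zero h03 (by simpa using h3)
    simp [hh] at h3ne
  have not_a_zero_and_d_zero : a = 0 → d = 0 → False := by
    intro ha hd
    have hb : (b : ℝ) ≠ 0 := by exact_mod_cast not_a_zero_and_b_zero ha
    have hf : (f : ℝ) ≠ 0 := by exact_mod_cast not_d_zero_and_f_zero hd
    rw [ha, Rat.cast_zero] at h1
    rw [hd, Rat.cast_zero] at h2
    refine not_rational (-e / f) (-c / b) ?_ ?_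
    · push_cast
      field_simp
      linarith
    · push_cast
      field_simp
      linarith
  rw [Fintype.linearIndependent_iff]
  intro k hk
  simp only [Fin.sum_univ_three] at hk
  have hk0 : k 2 = 0 ∨ g = 0 := by simpa using congrFun hk 0
  have hk1 : k 1 = 0 ∨ d = 0 := by simpa using congrFun hk 1
  have hk2 : k 1 * f + k 2 * h = 0 := by simpa using congrFun hk 2
  have hk3 : k 0 = 0 ∨ a = 0 := by simpa using congrFun hk 3
  have hk4 : k 0 * b + k 2 * i = 0 := by simpa using congrFun hk 4
  have hk5 : k 0 * c + k 1 * e = 0 := by simpa using congrFun hk 5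
  have hall : k 0 = 0 ∧ k 1 = 0 ∧ k 2 = 0 := by
    clear hk h1 h2 h3 h1ne h2ne h3ne not_rational coeff_eq_zero
    grind
  intro j
  fin_cases j
  · exact hall.1
  · exact hall.2.1
  · exact hall.2.2
end

section
/- Let u, v ∈ ℝ⁴ be linearly independent and E = span{u, v}. (i) If p, q, r, x ∈ ℝ are such that the vector (p, q, r, x) belongs to E, then p·G23 − q·G13 + r·G12 = 0. (ii) Conversely, if (G12, G13, G23) ≠ (0,0,0) and p, q, r ∈ ℝ satisfy p·G23 − q·G13 + r·G12 = 0, then there exists x ∈ ℝ such that (p, q, r, x) ∈ E. In particular, E has a subperiod p·G23 − q·G13 + r·G12 = 0 of type 4 (with p, q, r rational) if and only if E contains a line directed by a vector of the form (p, q, r, x). -/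
/-- If two vectors of `K³` have a nonzero minor, then any vector whose determinant with them
vanishes is a linear combination of them. -/
theorem exists_combination_of_det_eq_zero {K : Type*} [Field K] {u₀ u₁ u₂ v₀ v₁ v₂ p q r : K}
    (hne : ¬ (u₀ * v₁ - u₁ * v₀ = 0 ∧ u₀ * v₂ - u₂ * v₀ = 0 ∧ u₁ * v₂ - u₂ * v₁ = 0))
    (h : p * (u₁ * v₂ - u₂ * v₁) - q * (u₀ * v₂ - u₂ * v₀) + r * (u₀ * v₁ - u₁ * v₀) = 0) :
    ∃ a b : K, a * u₀ + b * v₀ = p ∧ a * u₁ + b * v₁ = q ∧ a * u₂ + b * v₂ = r := by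
  by_cases h01 : u₀ * v₁ - u₁ * v₀ = 0
  · by_cases h02 : u₀ * v₂ - u₂ * v₀ = 0
    · have h12 : u₁ * v₂ - u₂ * v₁ ≠ 0 := fun h12 => hne ⟨h01, h02, h12⟩
      refine ⟨(q * v₂ - r * v₁) / (u₁ * v₂ - u₂ * v₁), (u₁ * r - u₂ * q) / (u₁ * v₂ - u₂ * v₁),
        ?_, ?_, ?_⟩ <;> rw [div_mul_eq_mul_div, div_mul_eq_mul_div, ← add_div, div_eq_iff h12]
      · linear_combination -h
      · ring
      · ring
    · refine ⟨(p * v₂ - r * v₀) / (u₀ * v₂ - u₂ * v₀), (u₀ * r - u₂ * p) / (u₀ * v₂ - u₂ * v₀),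
        ?_, ?_, ?_⟩ <;> rw [div_mul_eq_mul_div, div_mul_eq_mul_div, ← add_div, div_eq_iff h02]
      · ring
      · linear_combination h
      · ring
  · refine ⟨(p * v₁ - q * v₀) / (u₀ * v₁ - u₁ * v₀), (u₀ * q - u₁ * p) / (u₀ * v₁ - u₁ * v₀),
      ?_, ?_, ?_⟩ <;> rw [div_mul_eq_mul_div, div_mul_eq_mul_div, ← add_div, div_eq_iff h01]
    · ring
    · ring
    · linear_combination -h

/-- (i) if `(p, q, r, x) ∈ E = span{u, v}` then
`p·G23 - q·G13 + r·G12 = 0`; (ii) conversely, if `(G12, G13, G23) ≠ (0,0,0)` and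
`p·G23 - q·G13 + r·G12 = 0`, then `(p, q, r, x) ∈ E` for some `x ∈ ℝ`.
(Indices: `G12 = G 0 1`, `G13 = G 0 2`, `G23 = G 1 2`.) -/
theorem stmt_4 (u v : Fin 4 → ℝ)
    (hindep : LinearIndependent ℝ ![u, v])
    (G : Fin 4 → Fin 4 → ℝ)
    (hG : ∀ i j, G i j = u i * v j - u j * v i) :
    (∀ p q r x : ℝ, (![p, q, r, x] : Fin 4 → ℝ) ∈ Submodule.span ℝ ({u, v} : Set (Fin 4 → ℝ)) →
        p * G 1 2 - q * G 0 2 + r * G 0 1 = 0) ∧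
    (¬ (G 0 1 = 0 ∧ G 0 2 = 0 ∧ G 1 2 = 0) →
      ∀ p q r : ℝ, p * G 1 2 - q * G 0 2 + r * G 0 1 = 0 →
        ∃ x : ℝ, (![p, q, r, x] : Fin 4 → ℝ) ∈ Submodule.span ℝ ({u, v} : Set (Fin 4 → ℝ))) := by
  simp only [hG, Submodule.mem_span_pair]
  refine ⟨?_, fun hne p q r h => ?_⟩
  · rintro p q r x ⟨a, b, hab⟩
    have h0 : a * u 0 + b * v 0 = p := by simpa using congrFun hab 0
    have h1 : a * u 1 + b * v 1 = q := by simpa using congrFun hab 1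
    have h2 : a * u 2 + b * v 2 = r := by simpa using congrFun hab 2
    subst h0 h1 h2
    ring
  · obtain ⟨a, b, h0, h1, h2⟩ := exists_combination_of_det_eq_zero hne h
    refine ⟨a * u 3 + b * v 3, a, b, ?_⟩
    ext i
    fin_cases i <;> simp [h0, h1, h2]
end

section
/- Let u, v ∈ ℝ⁴ be linearly independent with Grassmann coordinates satisfying G24 ≠ 0 and G34 ≠ 0, and let E = span{u, v}. Let x, y, z ∈ ℝ and a, b, c, d, e, f, g, h, i ∈ ℤ, and suppose that the two vectors (x − d, a − y, b − e, c − f) and (x − g, a − h, b − z, c − i) both belong to E. Then (d − g)·G24·G34 + (b − e)·G14·G24 − (c − f)·G13·G24 − (a − h)·G14·G34 + (c − i)·G12·G34 = 0. (This is the algebraic equation, with integer coefficients, that a coincidence of E imposes on its Grassmann coordinates: the three points (x,a,b,c), (d,y,e,f), (g,h,z,i), which have integer entries except in positions 1, 2, 3 respectively, project to a common point of the window of E.) -/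
/-- Any three coordinates of a vector in `span {u, v}` satisfy the linear relation obtained by
expanding the vanishing `3 × 3` minor of `w, u, v`. -/
theorem minor_eq_zero_of_mem_span_pair {R ι : Type*} [CommRing R] {u v w : ι → R}
    (hw : w ∈ Submodule.span R {u, v}) (i j k : ι) :
    w i * (u j * v k - u k * v j) - w j * (u i * v k - u k * v i)
      + w k * (u i * v j - u j * v i) = 0 := by
  obtain ⟨s, t, rfl⟩ := Submodule.mem_span_pair.mp hw
  simp only [Pi.add_apply, Pi.smul_apply, smul_eq_mul]
  ring

/-- the algebraic equation imposed by a coincidence. If the points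
`(x,a,b,c)`, `(d,y,e,f)`, `(g,h,z,i)` (integer entries except in positions
1, 2, 3 respectively) project to a common point of the window of
`E = span{u, v}`, i.e. their pairwise differences lie in `E`, then
`(d-g)·G24·G34 + (b-e)·G14·G24 - (c-f)·G13·G24 - (a-h)·G14·G34 + (c-i)·G12·G34 = 0`.
(Indices: `G12 = G 0 1`, `G13 = G 0 2`, `G14 = G 0 3`, `G24 = G 1 3`, `G34 = G 2 3`.) -/
theorem stmt_5 (u v : Fin 4 → ℝ)
    (hindep : LinearIndependent ℝ ![u, v])
    (G : Fin 4 → Fin 4 → ℝ)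
    (hG : ∀ i j, G i j = u i * v j - u j * v i)
    (hG24 : G 1 3 ≠ 0) (hG34 : G 2 3 ≠ 0)
    (x y z : ℝ) (a b c d e f g h i : ℤ)
    (h1 : (![x - (d : ℝ), (a : ℝ) - y, (b : ℝ) - (e : ℝ), (c : ℝ) - (f : ℝ)] : Fin 4 → ℝ)
      ∈ Submodule.span ℝ ({u, v} : Set (Fin 4 → ℝ)))
    (h2 : (![x - (g : ℝ), (a : ℝ) - (h : ℝ), (b : ℝ) - z, (c : ℝ) - (i : ℝ)] : Fin 4 → ℝ)
      ∈ Submodule.span ℝ ({u, v} : Set (Fin 4 → ℝ))) :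
    ((d : ℝ) - (g : ℝ)) * G 1 3 * G 2 3
      + ((b : ℝ) - (e : ℝ)) * G 0 3 * G 1 3
      - ((c : ℝ) - (f : ℝ)) * G 0 2 * G 1 3
      - ((a : ℝ) - (h : ℝ)) * G 0 3 * G 2 3
      + ((c : ℝ) - (i : ℝ)) * G 0 1 * G 2 3 = 0 := by
  have r1 := minor_eq_zero_of_mem_span_pair h1 0 2 3
  have r2 := minor_eq_zero_of_mem_span_pair h2 0 1 3
  simp only [← hG, Matrix.cons_val] at r1 r2
  linear_combination G 2 3 * r2 - G 1 3 * r1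
end

section
/- For every real t ≠ 0 there exist linearly independent vectors u, v ∈ ℝ⁴ whose Grassmann coordinates are (G12, G13, G14, G23, G24, G34) = (1, t, 1, 1, 2/t, 1). Each such plane satisfies the Plücker relation and the four subperiod relations of the Ammann–Beenker plane, namely G23 = G34, G14 = G34, G12 = G14 and G12 = G23. Moreover, for t ∉ {√2, −√2}, the vector (1, t, 1, 1, 2/t, 1) is not proportional to (1, √2, 1, 1, √2, 1), the Grassmann coordinate vector of the Ammann–Beenker plane. Hence the subperiods of the Ammann–Beenker plane, together with the Plücker relation, do not determine that plane up to parallelism. -/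
/-- Two vectors with a nonzero Grassmann coordinate are linearly independent. -/
theorem linearIndependent_pair_of_minor_ne_zero {K ι : Type*} [Field K] {u v : ι → K} (i j : ι)
    (h : u i * v j - u j * v i ≠ 0) : LinearIndependent K ![u, v] := by
  refine LinearIndependent.pair_iff.2 fun a b hab => ?_
  have hi : a * u i + b * v i = 0 := by simpa using congrFun hab i
  have hj : a * u j + b * v j = 0 := by simpa using congrFun hab j
  constructor
  · refine (mul_eq_zero.1 ?_).resolve_right h
    linear_combination v j * hi - v i * hj
  · refine (mul_eq_zero.1 ?_).resolve_right h
    linear_combination u i * hj - u j * hi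

/-- for every real `t ≠ 0` there is a plane `span{u, v} ⊂ ℝ⁴` with
Grassmann coordinates `(G12, G13, G14, G23, G24, G34) = (1, t, 1, 1, 2/t, 1)`;
this vector satisfies the Plücker relation and the four subperiod relations
`G23 = G34`, `G14 = G34`, `G12 = G14`, `G12 = G23` of the Ammann–Beenker plane,
and for `t ∉ {√2, -√2}` it is not proportional to `(1, √2, 1, 1, √2, 1)`. Hence
the subperiods of the Ammann–Beenker plane together with the Plücker relation do
not determine it up to parallelism. -/
theorem stmt_8 (t : ℝ) (ht : t ≠ 0) :
    (∃ u v : Fin 4 → ℝ, LinearIndependent ℝ ![u, v] ∧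
      u 0 * v 1 - u 1 * v 0 = 1 ∧
      u 0 * v 2 - u 2 * v 0 = t ∧
      u 0 * v 3 - u 3 * v 0 = 1 ∧
      u 1 * v 2 - u 2 * v 1 = 1 ∧
      u 1 * v 3 - u 3 * v 1 = 2 / t ∧
      u 2 * v 3 - u 3 * v 2 = 1) ∧
    (∀ g : Fin 6 → ℝ, g = ![1, t, 1, 1, 2 / t, 1] →
      g 0 * g 5 = g 1 * g 4 - g 2 * g 3 ∧
      g 3 = g 5 ∧ g 2 = g 5 ∧ g 0 = g 2 ∧ g 0 = g 3) ∧
    (t ≠ Real.sqrt 2 → t ≠ -Real.sqrt 2 →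
      ¬ ∃ c : ℝ, (![1, t, 1, 1, 2 / t, 1] : Fin 6 → ℝ) =
        c • ![1, Real.sqrt 2, 1, 1, Real.sqrt 2, 1]) := by
  refine ⟨⟨![1, 0, -1, -(2 / t)], ![0, 1, t, 1],
    linearIndependent_pair_of_minor_ne_zero 0 1 (by simp), ?_⟩, ?_, ?_⟩
  · simp [ht]
    norm_num
  · rintro g rfl
    simp [mul_div_cancel₀ _ ht]
    norm_num
  · rintro h - ⟨c, hc⟩
    have h0 : 1 = c := by simpa using congrFun hc 0
    have h1 : t = c * Real.sqrt 2 := by simpa using congrFun hc 1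
    exact h (by rw [h1, ← h0, one_mul])
end

section
/- Let u, v ∈ ℝ⁴ be linearly independent, E = span{u, v}, and suppose E is nondegenerate and irrational. Suppose there are nonzero rational triples (p,a,b), (q,c,d), (r,e,f) with p·G23 = a·G12 + b·G13 (subperiod of type 4), q·G24 = c·G12 + d·G14 (subperiod of type 3), r·G34 = e·G13 + f·G14 (subperiod of type 2), and integers k₁, …, k₅ with k₁·G12·G34 + k₂·G13·G24 + k₃·G14·G24 + k₄·G14·G34 + k₅·G24·G34 = 0 (a coincidence equation). Assume moreover that the set of one-dimensional subspaces ℝ·H of ℝ⁶, where H = (H12, H13, H14, H23, H24, H34) is nonzero and satisfies H12·H34 = H13·H24 − H14·H23, p·H23 = a·H12 + b·H13, q·H24 = c·H12 + d·H14, r·H34 = e·H13 + f·H14, and k₁·H12·H34 + k₂·H13·H24 + k₃·H14·H24 + k₄·H14·H34 + k₅·H24·H34 = 0, is finite. Then the field ℚ(G13/G12, G14/G12, G23/G12, G24/G12, G34/G12) is an extension of ℚ of degree at most 2; that is, after rescaling, all six Grassmann coordinates of E lie in a common real quadratic number field. -/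
open IntermediateField Polynomial in
/-- A set of elements of `ℚ(s)`, where `s` is a root of a nonzero rational quadratic,
generates an extension of degree at most two. -/
theorem finrank_adjoin_le_two_of_quadratic {S : Set ℝ} {s : ℝ} {A B C : ℚ}
    (hne : ¬(A = 0 ∧ B = 0 ∧ C = 0))
    (hs : (A : ℝ) * s ^ 2 + B * s + C = 0) (hS : S ⊆ ℚ⟮s⟯) :
    FiniteDimensional ℚ (adjoin ℚ S) ∧ Module.finrank ℚ (adjoin ℚ S) ≤ 2 := by
  have hle : adjoin ℚ S ≤ ℚ⟮s⟯ := adjoin_le_iff.2 hS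
  set P : ℚ[X] := Polynomial.C A * X ^ 2 + Polynomial.C B * X + Polynomial.C C with hP
  have hP0 : P ≠ 0 := by
    intro h
    refine hne ⟨?_, ?_, ?_⟩
    · simpa [hP, coeff_X, coeff_C] using congrArg (fun Q : ℚ[X] => Q.coeff 2) h
    · simpa [hP, coeff_X, coeff_C] using congrArg (fun Q : ℚ[X] => Q.coeff 1) h
    · simpa [hP, coeff_X, coeff_C] using congrArg (fun Q : ℚ[X] => Q.coeff 0) h
  have hroot : aeval s P = 0 := by simpa [hP] using hs
  have hint : IsIntegral ℚ s := IsAlgebraic.isIntegral ⟨P, hP0, hroot⟩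
  have hfd : FiniteDimensional ℚ ℚ⟮s⟯ := adjoin.finiteDimensional hint
  have hrank : Module.finrank ℚ ℚ⟮s⟯ ≤ 2 := by
    rw [adjoin.finrank hint]
    exact (natDegree_le_of_dvd (minpoly.dvd ℚ s hroot) hP0).trans natDegree_quadratic_le
  have hle' : (adjoin ℚ S).toSubalgebra.toSubmodule ≤ (ℚ⟮s⟯).toSubalgebra.toSubmodule := hle
  have : FiniteDimensional ℚ (ℚ⟮s⟯).toSubalgebra.toSubmodule := hfd
  exact ⟨Submodule.finiteDimensional_of_le hle', (Submodule.finrank_mono hle').trans hrank⟩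

/-- The subperiod, Plücker and coincidence equations, normalized by `G12 = 1`, for
`x = G13`, `y = G14`, `z = G23`, `w = G24`, `t = G34`. -/
def AffineSystem (p a b q c d r e f k₁ k₂ k₃ k₄ k₅ : ℚ) (x y z w t : ℝ) : Prop :=
  t = x * w - y * z ∧ p * z = a + b * x ∧ q * w = c + d * y ∧ r * t = e * x + f * y ∧
    k₁ * t + k₂ * x * w + k₃ * y * w + k₄ * y * t + k₅ * w * t = 0

/-- A family of solutions parametrized by one of the coordinates `x`, `y`, outside the zero of
a nonzero affine function. -/
def HasSolutionCurve (p a b q c d r e f k₁ k₂ k₃ k₄ k₅ : ℚ) : Prop :=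
  ∃ (l m : ℝ) (X Y Z W T : ℝ → ℝ), ¬(l = 0 ∧ m = 0) ∧ ((∀ s, X s = s) ∨ ∀ s, Y s = s) ∧
    ∀ s, l * s + m ≠ 0 →
      AffineSystem p a b q c d r e f k₁ k₂ k₃ k₄ k₅ (X s) (Y s) (Z s) (W s) (T s)

theorem infinite_setOf_affine_ne_zero {l m : ℝ} (h : ¬(l = 0 ∧ m = 0)) :
    {s : ℝ | l * s + m ≠ 0}.Infinite := by
  have hsub : {s : ℝ | l * s + m = 0}.Subsingleton := by
    intro s hs s' hs'
    change l * s + m = 0 at hs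
    change l * s' + m = 0 at hs'
    by_contra hss
    have hl : l = 0 := by
      have : l * (s - s') = 0 := by linear_combination hs - hs'
      exact (mul_eq_zero.1 this).resolve_right (sub_ne_zero.2 hss)
    exact h ⟨hl, by simpa [hl] using hs⟩
  exact hsub.finite.infinite_compl

theorem HasSolutionCurve.infinite {p a b q c d r e f k₁ k₂ k₃ k₄ k₅ : ℚ}
    (h : HasSolutionCurve p a b q c d r e f k₁ k₂ k₃ k₄ k₅) :
    Set.Infinite {L : Submodule ℝ (Fin 6 → ℝ) | ∃ H : Fin 6 → ℝ, H ≠ 0 ∧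
      L = Submodule.span ℝ {H} ∧
      H 0 * H 5 = H 1 * H 4 - H 2 * H 3 ∧
      (p : ℝ) * H 3 = (a : ℝ) * H 0 + (b : ℝ) * H 1 ∧
      (q : ℝ) * H 4 = (c : ℝ) * H 0 + (d : ℝ) * H 2 ∧
      (r : ℝ) * H 5 = (e : ℝ) * H 1 + (f : ℝ) * H 2 ∧
      (k₁ : ℝ) * H 0 * H 5 + (k₂ : ℝ) * H 1 * H 4 + (k₃ : ℝ) * H 2 * H 4
        + (k₄ : ℝ) * H 2 * H 5 + (k₅ : ℝ) * H 4 * H 5 = 0} := by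
  obtain ⟨l, m, X, Y, Z, W, T, hlm, hXY, hsol⟩ := h
  refine Set.infinite_of_injOn_mapsTo
    (f := fun s => Submodule.span ℝ {![1, X s, Y s, Z s, W s, T s]}) ?_ ?_
    (infinite_setOf_affine_ne_zero hlm)
  · intro s _ s' _ hss
    have hmem : ![1, X s, Y s, Z s, W s, T s] ∈
        Submodule.span ℝ {![1, X s', Y s', Z s', W s', T s']} := by
      simp only at hss
      rw [← hss]
      exact Submodule.mem_span_singleton_self _
    obtain ⟨μ, hμ⟩ := Submodule.mem_span_singleton.1 hmem
    have h0 : μ = 1 := by simpa using congrFun hμ 0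
    subst h0
    have h1 : X s' = X s := by simpa using congrFun hμ 1
    have h2 : Y s' = Y s := by simpa using congrFun hμ 2
    rcases hXY with h | h
    · rw [← h s, ← h s', h1]
    · rw [← h s, ← h s', h2]
  · intro s hs
    obtain ⟨e1, e2, e3, e4, e5⟩ := hsol s hs
    refine ⟨_, ?_, rfl, ?_, ?_, ?_, ?_, ?_⟩
    · intro h
      simpa using congrFun h 0
    · simpa using e1
    · simpa using e2
    · simpa using e3
    · simpa using e4
    · simpa using e5

open IntermediateField in
/-- If the normalized system has no curve of solutions, then a solution with nonzero coordinates
whose `x`, `y` are not both rational generates an extension of degree at most two. -/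
theorem AffineSystem.finrank_adjoin_le_two {p a b q c d r e f k₁ k₂ k₃ k₄ k₅ : ℚ} {x y z w t : ℝ}
    (h : AffineSystem p a b q c d r e f k₁ k₂ k₃ k₄ k₅ x y z w t) (hx : x ≠ 0) (hy : y ≠ 0)
    (hirr : ∀ x' y' : ℚ, x = x' → y ≠ y')
    (hpne : (p, a, b) ≠ (0, 0, 0)) (hqne : (q, c, d) ≠ (0, 0, 0)) (hrne : (r, e, f) ≠ (0, 0, 0))
    (hno : ¬HasSolutionCurve p a b q c d r e f k₁ k₂ k₃ k₄ k₅) :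
    FiniteDimensional ℚ (adjoin ℚ ({x, y, z, w, t} : Set ℝ)) ∧
      Module.finrank ℚ (adjoin ℚ ({x, y, z, w, t} : Set ℝ)) ≤ 2 := by
  obtain ⟨e1, e2, e3, e4, e5⟩ := h
  have key : ∀ (s : ℝ) (A B C : ℚ), ¬(A = 0 ∧ B = 0 ∧ C = 0) → (A : ℝ) * s ^ 2 + B * s + C = 0 →
      x ∈ ℚ⟮s⟯ → y ∈ ℚ⟮s⟯ → z ∈ ℚ⟮s⟯ → w ∈ ℚ⟮s⟯ →
      FiniteDimensional ℚ (adjoin ℚ ({x, y, z, w, t} : Set ℝ)) ∧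
        Module.finrank ℚ (adjoin ℚ ({x, y, z, w, t} : Set ℝ)) ≤ 2 := by
    intro s A B C hne hs mx my mz mw
    refine finrank_adjoin_le_two_of_quadratic hne hs ?_
    have mt : t ∈ ℚ⟮s⟯ := e1 ▸ sub_mem (mul_mem mx mw) (mul_mem my mz)
    rintro _ (rfl | rfl | rfl | rfl | rfl) <;> assumption
  have mq : ∀ (s : ℝ) (g : ℚ), (g : ℝ) ∈ ℚ⟮s⟯ := fun s g => (ℚ⟮s⟯).algebraMap_mem g
  have ms : ∀ s : ℝ, s ∈ ℚ⟮s⟯ := fun s => mem_adjoin_simple_self ℚ s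
  have ratx : p = 0 → ∃ x' : ℚ, x = x' := by
    rintro rfl
    have hb : b ≠ 0 := by
      rintro rfl
      have : a = 0 := by simpa using e2.symm
      simp [this] at hpne
    refine ⟨-a / b, ?_⟩
    push_cast at e2 ⊢
    field_simp
    linear_combination -e2
  have raty : q = 0 → ∃ y' : ℚ, y = y' := by
    rintro rfl
    have hd : d ≠ 0 := by
      rintro rfl
      have : c = 0 := by simpa using e3.symm
      simp [this] at hqne
    refine ⟨-c / d, ?_⟩
    push_cast at e3 ⊢
    field_simp
    linear_combination -e3
  have ratyx : r = 0 → ∃ m : ℚ, m ≠ 0 ∧ y = m * x ∧ (e : ℝ) + f * m = 0 := by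
    rintro rfl
    have hf : f ≠ 0 := by
      rintro rfl
      have : e = 0 := by simpa [hx] using e4
      simp [this] at hrne
    have he : e ≠ 0 := by
      rintro rfl
      simp [hf, hy] at e4
    refine ⟨-e / f, div_ne_zero (neg_ne_zero.2 he) hf, ?_, ?_⟩
    · push_cast at e4 ⊢
      field_simp
      linear_combination -e4
    · push_cast
      field_simp
      ring
  by_cases hp : p = 0
  · obtain ⟨x₀, rfl⟩ := ratx hp
    have hq : q ≠ 0 := fun hq => by
      obtain ⟨y₀, h⟩ := raty hq
      exact hirr x₀ y₀ rfl h
    have hr : r ≠ 0 := fun hr => by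
      obtain ⟨m, -, h, -⟩ := ratyx hr
      exact hirr x₀ (m * x₀) rfl (by simpa using h)
    subst hp
    obtain ⟨C, rfl⟩ : ∃ C, c = q * C := ⟨c / q, by field_simp⟩
    obtain ⟨D, rfl⟩ : ∃ D, d = q * D := ⟨d / q, by field_simp⟩
    obtain ⟨E, rfl⟩ : ∃ E, e = r * E := ⟨e / r, by field_simp⟩
    obtain ⟨F, rfl⟩ : ∃ F, f = r * F := ⟨f / r, by field_simp⟩
    have hq' : (q : ℝ) ≠ 0 := by exact_mod_cast hq
    have hr' : (r : ℝ) ≠ 0 := by exact_mod_cast hr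
    have hw : w = C + D * y := mul_left_cancel₀ hq' (by push_cast at e3; linear_combination e3)
    have ht : t = E * x₀ + F * y := mul_left_cancel₀ hr' (by push_cast at e4; linear_combination e4)
    have hz : z = (x₀ * w - t) / y := by field_simp; linear_combination e1
    by_cases hABC : k₃ * D + k₄ * F + k₅ * D * F = 0 ∧
        k₁ * F + k₂ * x₀ * D + k₃ * C + k₄ * E * x₀ + k₅ * (C * F + D * E * x₀) = 0 ∧
        k₁ * E * x₀ + k₂ * x₀ * C + k₅ * C * E * x₀ = 0
    · obtain ⟨h2, h1, h0⟩ := hABC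
      refine absurd ⟨1, 0, fun _ => x₀, fun s => s,
        fun s => (x₀ * (C + D * s) - (E * x₀ + F * s)) / s, fun s => C + D * s,
        fun s => E * x₀ + F * s, by simp, Or.inr fun _ => rfl, ?_⟩ hno
      intro s hs
      have hs : s ≠ 0 := by simpa using hs
      replace h2 := congrArg (Rat.cast : ℚ → ℝ) h2
      replace h1 := congrArg (Rat.cast : ℚ → ℝ) h1
      replace h0 := congrArg (Rat.cast : ℚ → ℝ) h0
      push_cast at h0 h1 h2
      refine ⟨by field_simp; ring, by simpa using e2, by push_cast; ring, by push_cast; ring, ?_⟩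
      linear_combination h0 + s * h1 + s ^ 2 * h2
    · have mw : w ∈ ℚ⟮y⟯ := hw ▸ add_mem (mq _ _) (mul_mem (mq _ _) (ms _))
      have mt : t ∈ ℚ⟮y⟯ := ht ▸ add_mem (mul_mem (mq _ _) (mq _ _)) (mul_mem (mq _ _) (ms _))
      refine key y _ _ _ hABC ?_ (mq _ _) (ms _)
        (hz ▸ div_mem (sub_mem (mul_mem (mq _ _) mw) mt) (ms _)) mw
      rw [hw, ht] at e5
      push_cast
      linear_combination e5
  obtain ⟨A, rfl⟩ : ∃ A, a = p * A := ⟨a / p, by field_simp⟩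
  obtain ⟨B, rfl⟩ : ∃ B, b = p * B := ⟨b / p, by field_simp⟩
  have hp' : (p : ℝ) ≠ 0 := by exact_mod_cast hp
  have hz : z = A + B * x := mul_left_cancel₀ hp' (by push_cast at e2; linear_combination e2)
  by_cases hq : q = 0
  · obtain ⟨y₀, rfl⟩ := raty hq
    have hr : r ≠ 0 := fun hr => by
      obtain ⟨m, hm, h, -⟩ := ratyx hr
      refine hirr (y₀ / m) y₀ ?_ rfl
      push_cast
      field_simp
      linear_combination -h
    subst hq
    obtain ⟨E, rfl⟩ : ∃ E, e = r * E := ⟨e / r, by field_simp⟩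
    obtain ⟨F, rfl⟩ : ∃ F, f = r * F := ⟨f / r, by field_simp⟩
    have hr' : (r : ℝ) ≠ 0 := by exact_mod_cast hr
    have ht : t = E * x + F * y₀ := mul_left_cancel₀ hr' (by push_cast at e4; linear_combination e4)
    have hw : w = (t + y₀ * z) / x := by field_simp; linear_combination -e1
    by_cases hABC : k₁ * E + k₂ * (E + y₀ * B) + k₄ * y₀ * E + k₅ * (E + y₀ * B) * E = 0 ∧
        k₁ * F * y₀ + k₂ * (F * y₀ + y₀ * A) + k₃ * y₀ * (E + y₀ * B) + k₄ * y₀ * F * y₀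
          + k₅ * ((E + y₀ * B) * F * y₀ + (F * y₀ + y₀ * A) * E) = 0 ∧
        k₃ * y₀ * (F * y₀ + y₀ * A) + k₅ * (F * y₀ + y₀ * A) * F * y₀ = 0
    · obtain ⟨h2, h1, h0⟩ := hABC
      refine absurd ⟨1, 0, fun s => s, fun _ => y₀, fun s => A + B * s,
        fun s => (E * s + F * y₀ + y₀ * (A + B * s)) / s, fun s => E * s + F * y₀, by simp,
        Or.inl fun _ => rfl, ?_⟩ hno
      intro s hs
      have hs : s ≠ 0 := by simpa using hs
      replace h2 := congrArg (Rat.cast : ℚ → ℝ) h2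
      replace h1 := congrArg (Rat.cast : ℚ → ℝ) h1
      replace h0 := congrArg (Rat.cast : ℚ → ℝ) h0
      push_cast at h0 h1 h2
      refine ⟨by field_simp; ring, by push_cast; ring, by simpa using e3, by push_cast; ring, ?_⟩
      field_simp
      linear_combination h0 + s * h1 + s ^ 2 * h2
    · have mz : z ∈ ℚ⟮x⟯ := hz ▸ add_mem (mq _ _) (mul_mem (mq _ _) (ms _))
      have mt : t ∈ ℚ⟮x⟯ := ht ▸ add_mem (mul_mem (mq _ _) (ms _)) (mul_mem (mq _ _) (mq _ _))
      refine key x _ _ _ hABC ?_ (ms _) (mq _ _) mz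
        (hw ▸ div_mem (add_mem mt (mul_mem (mq _ _) mz)) (ms _))
      rw [hw, hz, ht] at e5
      field_simp at e5
      push_cast
      linear_combination e5
  obtain ⟨C, rfl⟩ : ∃ C, c = q * C := ⟨c / q, by field_simp⟩
  obtain ⟨D, rfl⟩ : ∃ D, d = q * D := ⟨d / q, by field_simp⟩
  have hq' : (q : ℝ) ≠ 0 := by exact_mod_cast hq
  have hw : w = C + D * y := mul_left_cancel₀ hq' (by push_cast at e3; linear_combination e3)
  by_cases hr : r = 0
  · obtain ⟨m, hm, rfl, hef⟩ := ratyx hr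
    subst hr
    by_cases hABC : k₄ * m * (D * m - m * B) + k₅ * D * m * (D * m - m * B) = 0 ∧
        k₁ * (D * m - m * B) + (k₂ + k₃ * m) * D * m + k₄ * m * (C - m * A)
          + k₅ * (C * (D * m - m * B) + D * m * (C - m * A)) = 0 ∧
        k₁ * (C - m * A) + (k₂ + k₃ * m) * C + k₅ * C * (C - m * A) = 0
    · obtain ⟨h2, h1, h0⟩ := hABC
      refine absurd ⟨1, 0, fun s => s, fun s => m * s, fun s => A + B * s, fun s => C + D * (m * s),
        fun s => s * (C + D * (m * s)) - m * s * (A + B * s), by simp, Or.inl fun _ => rfl, ?_⟩ hno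
      intro s _
      replace h2 := congrArg (Rat.cast : ℚ → ℝ) h2
      replace h1 := congrArg (Rat.cast : ℚ → ℝ) h1
      replace h0 := congrArg (Rat.cast : ℚ → ℝ) h0
      push_cast at h0 h1 h2
      refine ⟨rfl, by push_cast; ring, by push_cast; ring, ?_, ?_⟩
      · push_cast
        linear_combination -s * hef
      · linear_combination s * h0 + s ^ 2 * h1 + s ^ 3 * h2
    · have my : (m * x : ℝ) ∈ ℚ⟮x⟯ := mul_mem (mq _ _) (ms _)
      refine key x _ _ _ hABC ?_ (ms _) my
        (hz ▸ add_mem (mq _ _) (mul_mem (mq _ _) (ms _))) (hw ▸ add_mem (mq _ _) (mul_mem (mq _ _) my))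
      rw [e1, hw, hz] at e5
      refine mul_left_cancel₀ hx ?_
      push_cast
      linear_combination e5
  obtain ⟨E, rfl⟩ : ∃ E, e = r * E := ⟨e / r, by field_simp⟩
  obtain ⟨F, rfl⟩ : ∃ F, f = r * F := ⟨f / r, by field_simp⟩
  have hr' : (r : ℝ) ≠ 0 := by exact_mod_cast hr
  have ht : t = E * x + F * y := mul_left_cancel₀ hr' (by push_cast at e4; linear_combination e4)
  have hplu : x * ((D - B) * y + (C - E)) = (A + F) * y := by
    linear_combination ht - e1 - x * hw + y * hz
  obtain ⟨P₁, hP₁⟩ : ∃ P₁, P₁ = k₂ * D + k₄ * E + k₅ * D * E := ⟨_, rfl⟩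
  obtain ⟨P₀, hP₀⟩ : ∃ P₀, P₀ = k₁ * E + k₂ * C + k₅ * C * E := ⟨_, rfl⟩
  obtain ⟨Q₂, hQ₂⟩ : ∃ Q₂, Q₂ = k₃ * D + k₄ * F + k₅ * D * F := ⟨_, rfl⟩
  obtain ⟨Q₁, hQ₁⟩ : ∃ Q₁, Q₁ = k₁ * F + k₃ * C + k₅ * C * F := ⟨_, rfl⟩
  have hcoin (x y : ℝ) : k₁ * (E * x + F * y) + k₂ * x * (C + D * y) + k₃ * y * (C + D * y)
      + k₄ * y * (E * x + F * y) + k₅ * (C + D * y) * (E * x + F * y) =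
      x * (P₁ * y + P₀) + y * (Q₂ * y + Q₁) := by
    rw [hP₁, hP₀, hQ₂, hQ₁]
    push_cast
    ring
  have mk_sol {x y : ℝ} (h : x * ((D - B) * y + (C - E)) = (A + F) * y)
      (h' : x * (P₁ * y + P₀) + y * (Q₂ * y + Q₁) = 0) :
      AffineSystem p (p * A) (p * B) q (q * C) (q * D) r (r * E) (r * F) k₁ k₂ k₃ k₄ k₅
        x y (A + B * x) (C + D * y) (E * x + F * y) :=
    ⟨by linear_combination -h, by push_cast; ring, by push_cast; ring, by push_cast; ring,
      by rw [hcoin, h']⟩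
  rw [hw, ht, hcoin] at e5
  by_cases hL : ((D - B) * y + (C - E) : ℝ) = 0
  · have hAF : (A + F : ℝ) = 0 := by
      rw [hL, mul_zero] at hplu
      exact (mul_eq_zero.1 hplu.symm).resolve_right hy
    by_cases hDB : D - B = 0
    · have hDB' : (D - B : ℝ) = 0 := by exact_mod_cast hDB
      have hCE : (C - E : ℝ) = 0 := by simpa [hDB'] using hL
      by_cases hP : (P₁ : ℝ) = 0 ∧ (P₀ : ℝ) = 0
      · refine absurd ⟨0, 1, fun s => s, fun _ => y, _, _, _, by simp, Or.inl fun _ => rfl,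
          fun s _ => mk_sol ?_ ?_⟩ hno
        · rw [hL, hAF]; ring
        · linear_combination e5 + (s - x) * (y * hP.1 + hP.2)
      · refine absurd ⟨P₁, P₀, fun s => -(s * (Q₂ * s + Q₁)) / (P₁ * s + P₀), fun s => s,
          _, _, _, hP, Or.inr fun _ => rfl, fun s hs => mk_sol ?_ ?_⟩ hno
        · rw [hDB', hCE, hAF]; ring
        · rw [div_mul_cancel₀ _ hs]; ring
    · obtain ⟨y₀, rfl⟩ : ∃ y₀ : ℚ, y = y₀ := by
        have hDB' : (D - B : ℝ) ≠ 0 := by exact_mod_cast hDB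
        refine ⟨-(C - E) / (D - B), ?_⟩
        push_cast
        field_simp
        linear_combination hL
      by_cases hABC : (0 : ℚ) = 0 ∧ P₁ * y₀ + P₀ = 0 ∧ y₀ * (Q₂ * y₀ + Q₁) = 0
      · obtain ⟨-, h1, h0⟩ := hABC
        replace h1 := congrArg (Rat.cast : ℚ → ℝ) h1
        replace h0 := congrArg (Rat.cast : ℚ → ℝ) h0
        push_cast at h0 h1
        refine absurd ⟨0, 1, fun s => s, fun _ => y₀, _, _, _, by simp, Or.inl fun _ => rfl,
          fun s _ => mk_sol ?_ ?_⟩ hno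
        · rw [hL, hAF]; ring
        · linear_combination s * h1 + h0
      · refine key x _ _ _ hABC ?_ (ms _) (mq _ _)
          (hz ▸ add_mem (mq _ _) (mul_mem (mq _ _) (ms _)))
          (hw ▸ add_mem (mq _ _) (mul_mem (mq _ _) (mq _ _)))
        push_cast
        linear_combination e5
  · have hxy : x = (A + F) * y / ((D - B) * y + (C - E)) := by
      rw [eq_div_iff hL, hplu]
    by_cases hABC : (D - B) * Q₂ = 0 ∧ (A + F) * P₁ + (D - B) * Q₁ + (C - E) * Q₂ = 0 ∧
        (A + F) * P₀ + (C - E) * Q₁ = 0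
    · obtain ⟨h2, h1, h0⟩ := hABC
      replace h2 := congrArg (Rat.cast : ℚ → ℝ) h2
      replace h1 := congrArg (Rat.cast : ℚ → ℝ) h1
      replace h0 := congrArg (Rat.cast : ℚ → ℝ) h0
      push_cast at h0 h1 h2
      refine absurd ⟨D - B, C - E, fun s => (A + F) * s / ((D - B) * s + (C - E)), fun s => s,
        _, _, _, fun h => hL (by rw [h.1, h.2]; ring), Or.inr fun _ => rfl,
        fun s hs => mk_sol (div_mul_cancel₀ _ hs) ?_⟩ hno
      refine mul_left_cancel₀ hs ?_
      linear_combination s * h0 + s ^ 2 * h1 + s ^ 3 * h2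
        + (P₁ * s + P₀) * div_mul_cancel₀ ((A + F) * s : ℝ) hs
    · have mx : x ∈ ℚ⟮y⟯ := by
        have hα := sub_mem (mq y D) (mq y B)
        have hβ := sub_mem (mq y C) (mq y E)
        rw [hxy]
        exact div_mem (mul_mem (add_mem (mq _ _) (mq _ _)) (ms _)) (add_mem (mul_mem hα (ms _)) hβ)
      refine key y _ _ _ hABC ?_ mx (ms _) (hz ▸ add_mem (mq _ _) (mul_mem (mq _ _) mx))
        (hw ▸ add_mem (mq _ _) (mul_mem (mq _ _) (ms _)))
      refine mul_left_cancel₀ hy ?_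
      push_cast
      linear_combination ((D - B) * y + (C - E)) * e5 - (P₁ * y + P₀) * hplu


/-- case A of Lemma "fourth subperiod", quadraticity: a
nondegenerate irrational plane `span{u, v}` with subperiods of types 4, 3, 2 and
a coincidence equation, such that the projective solution set of these equations
together with the Plücker relation is finite, has all its Grassmann coordinates
(after normalizing `G12` to 1) in a common field extension of `ℚ` of degree at
most 2. (Coordinates of `H ∈ ℝ⁶` ordered as `H12, H13, H14, H23, H24, H34`;
indices: `G12 = G 0 1`, `G13 = G 0 2`, `G14 = G 0 3`, `G23 = G 1 2`,
`G24 = G 1 3`, `G34 = G 2 3`.) -/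
theorem stmt_10 (u v : Fin 4 → ℝ)
    (hindep : LinearIndependent ℝ ![u, v])
    (G : Fin 4 → Fin 4 → ℝ)
    (hG : ∀ i j, G i j = u i * v j - u j * v i)
    (hnondeg : G 0 1 ≠ 0 ∧ G 0 2 ≠ 0 ∧ G 0 3 ≠ 0 ∧ G 1 2 ≠ 0 ∧ G 1 3 ≠ 0 ∧ G 2 3 ≠ 0)
    (hirr : ∀ w : Fin 4 → ℝ, w ∈ Submodule.span ℝ ({u, v} : Set (Fin 4 → ℝ)) →
      (∀ i, ∃ q : ℚ, w i = (q : ℝ)) → w = 0)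
    (p a b q c d r e f : ℚ)
    (hpne : (p, a, b) ≠ (0, 0, 0)) (hqne : (q, c, d) ≠ (0, 0, 0))
    (hrne : (r, e, f) ≠ (0, 0, 0))
    (hsp4 : (p : ℝ) * G 1 2 = (a : ℝ) * G 0 1 + (b : ℝ) * G 0 2)
    (hsp3 : (q : ℝ) * G 1 3 = (c : ℝ) * G 0 1 + (d : ℝ) * G 0 3)
    (hsp2 : (r : ℝ) * G 2 3 = (e : ℝ) * G 0 2 + (f : ℝ) * G 0 3)
    (k₁ k₂ k₃ k₄ k₅ : ℤ)
    (hco : (k₁ : ℝ) * G 0 1 * G 2 3 + (k₂ : ℝ) * G 0 2 * G 1 3 + (k₃ : ℝ) * G 0 3 * G 1 3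
      + (k₄ : ℝ) * G 0 3 * G 2 3 + (k₅ : ℝ) * G 1 3 * G 2 3 = 0)
    (hfin : Set.Finite {L : Submodule ℝ (Fin 6 → ℝ) | ∃ H : Fin 6 → ℝ, H ≠ 0 ∧
      L = Submodule.span ℝ {H} ∧
      H 0 * H 5 = H 1 * H 4 - H 2 * H 3 ∧
      (p : ℝ) * H 3 = (a : ℝ) * H 0 + (b : ℝ) * H 1 ∧
      (q : ℝ) * H 4 = (c : ℝ) * H 0 + (d : ℝ) * H 2 ∧
      (r : ℝ) * H 5 = (e : ℝ) * H 1 + (f : ℝ) * H 2 ∧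
      (k₁ : ℝ) * H 0 * H 5 + (k₂ : ℝ) * H 1 * H 4 + (k₃ : ℝ) * H 2 * H 4
        + (k₄ : ℝ) * H 2 * H 5 + (k₅ : ℝ) * H 4 * H 5 = 0}) :
    FiniteDimensional ℚ (IntermediateField.adjoin ℚ
      ({G 0 2 / G 0 1, G 0 3 / G 0 1, G 1 2 / G 0 1, G 1 3 / G 0 1, G 2 3 / G 0 1} : Set ℝ)) ∧
    Module.finrank ℚ (IntermediateField.adjoin ℚ
      ({G 0 2 / G 0 1, G 0 3 / G 0 1, G 1 2 / G 0 1, G 1 3 / G 0 1, G 2 3 / G 0 1} : Set ℝ)) ≤ 2 := by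
  
  obtain ⟨h01, h02, h03, -, -, -⟩ := hnondeg
  have hplu : G 0 1 * G 2 3 = G 0 2 * G 1 3 - G 0 3 * G 1 2 := by
    simp only [hG]; ring
  refine AffineSystem.finrank_adjoin_le_two (p := p) (a := a) (b := b) (q := q) (c := c) (d := d)
    (r := r) (e := e) (f := f) (k₁ := k₁) (k₂ := k₂) (k₃ := k₃) (k₄ := k₄) (k₅ := k₅)
    ⟨?_, ?_, ?_, ?_, ?_⟩ (div_ne_zero h02 h01) (div_ne_zero h03 h01) ?_ hpne hqne hrne
    fun h => h.infinite (by simpa using hfin)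
  · field_simp
    linear_combination hplu
  · field_simp
    linear_combination hsp4
  · field_simp
    linear_combination hsp3
  · field_simp
    linear_combination hsp2
  · push_cast
    field_simp
    linear_combination hco
  · intro x' y' hx hy
    have hmem : (G 0 1)⁻¹ • (u 0 • v - v 0 • u) ∈ Submodule.span ℝ ({u, v} : Set (Fin 4 → ℝ)) :=
      Submodule.smul_mem _ _ (sub_mem
        (Submodule.smul_mem _ _ (Submodule.subset_span (by simp)))
        (Submodule.smul_mem _ _ (Submodule.subset_span (by simp))))
    have hval : ∀ i, ((G 0 1)⁻¹ • (u 0 • v - v 0 • u)) i = G 0 i / G 0 1 := by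
      intro i
      simp only [Pi.smul_apply, Pi.sub_apply, smul_eq_mul, hG 0 i]
      ring
    have hzero := hirr _ hmem fun i => by
      rw [hval]
      fin_cases i
      · exact ⟨0, by simp [hG 0 0]⟩
      · exact ⟨1, by simp [h01]⟩
      · exact ⟨x', hx⟩
      · exact ⟨y', hy⟩
    have h1 := congrFun hzero 1
    rw [hval, div_self h01] at h1
    exact one_ne_zero h1
end

section
/- Let u, v ∈ ℝ⁴ be linearly independent, E = span{u, v}, and suppose E is nondegenerate and irrational. Suppose there are nonzero rational triples (p,a,b), (q,c,d), (r,e,f) with p·G23 = a·G12 + b·G13 (subperiod of type 4), q·G24 = c·G12 + d·G14 (subperiod of type 3), r·G34 = e·G13 + f·G14 (subperiod of type 2), and integers k₁, …, k₅ with k₁·G12·G34 + k₂·G13·G24 + k₃·G14·G24 + k₄·G14·G34 + k₅·G24·G34 = 0, such that the set of one-dimensional subspaces ℝ·H of ℝ⁶ of nonzero solutions H = (H12, H13, H14, H23, H24, H34) of the Plücker relation, the three subperiod equations, and the last equation is finite. Then E also has a subperiod of type 1: there exists a nonzero (α, β, γ) ∈ ℚ³ with α·G23 + β·G24 + γ·G34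 = 0; moreover the four coefficient vectors in ℚ⁶ of the linear forms p·G23 − a·G12 − b·G13, q·G24 − c·G12 − d·G14, r·G34 − e·G13 − f·G14 and α·G23 + β·G24 + γ·G34 (on the six Grassmann coordinates) are linearly independent. -/
/-- The Plücker relation, three subperiod equations and the additional coincidence equation, for
coordinates ordered as `H12, H13, H14, H23, H24, H34`. -/
def IsPluckerSolution (p a b q c d r e f : ℚ) (k₁ k₂ k₃ k₄ k₅ : ℤ) (H : Fin 6 → ℝ) : Prop :=
  H 0 * H 5 = H 1 * H 4 - H 2 * H 3 ∧
  (p : ℝ) * H 3 = (a : ℝ) * H 0 + (b : ℝ) * H 1 ∧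
  (q : ℝ) * H 4 = (c : ℝ) * H 0 + (d : ℝ) * H 2 ∧
  (r : ℝ) * H 5 = (e : ℝ) * H 1 + (f : ℝ) * H 2 ∧
  (k₁ : ℝ) * H 0 * H 5 + (k₂ : ℝ) * H 1 * H 4 + (k₃ : ℝ) * H 2 * H 4
    + (k₄ : ℝ) * H 2 * H 5 + (k₅ : ℝ) * H 4 * H 5 = 0

/-- `P` fails somewhere on every curve, punctured at one parameter, whose `i`-th coordinate is the
parameter and whose `j`-th coordinate is `1`. -/
def NoSolutionCurve {n : ℕ} (P : (Fin n → ℝ) → Prop) : Prop :=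
  ∀ (i j : Fin n) (s₀ : ℝ) (g : ℝ → Fin n → ℝ),
    ¬ ∀ s, s ≠ s₀ → g s i = s ∧ g s j = 1 ∧ P (g s)

theorem noSolutionCurve_of_finite {n : ℕ} {P : (Fin n → ℝ) → Prop}
    (h : {L : Submodule ℝ (Fin n → ℝ) | ∃ H, H ≠ 0 ∧ L = Submodule.span ℝ {H} ∧ P H}.Finite) :
    NoSolutionCurve P := by
  intro i j s₀ g hg
  have hinf : ({s₀}ᶜ : Set ℝ).Infinite := (Set.finite_singleton s₀).infinite_compl
  refine Set.infinite_of_injOn_mapsTo (f := fun s => Submodule.span ℝ {g s}) ?_ ?_ hinf h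
  · intro s hs s' hs' hss
    have hmem : g s ∈ Submodule.span ℝ {g s'} := by
      have := Submodule.mem_span_singleton_self (R := ℝ) (g s)
      rwa [show Submodule.span ℝ {g s} = Submodule.span ℝ {g s'} from hss] at this
    obtain ⟨t, ht⟩ := Submodule.mem_span_singleton.1 hmem
    obtain ⟨h1, h2, -⟩ := hg s hs
    obtain ⟨h3, h4, -⟩ := hg s' hs'
    have hj := congrFun ht j
    have hi := congrFun ht i
    simp only [Pi.smul_apply, smul_eq_mul, h1, h2, h3, h4] at hi hj
    rw [← hi, show t = 1 by linarith, one_mul]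
  · intro s hs
    obtain ⟨-, h2, h3⟩ := hg s hs
    refine ⟨g s, fun h0 => ?_, rfl, h3⟩
    rw [h0] at h2
    simp at h2

/-- The Fredholm alternative for a rational `3 × 3` system. -/
theorem exists_combination_or_exists_orthogonal (u v w L : Fin 3 → ℚ) :
    (∃ α β γ : ℚ, ∀ i, L i = α * u i + β * v i + γ * w i) ∨
    ∃ x y z : ℚ, x * u 0 + y * u 1 + z * u 2 = 0 ∧ x * v 0 + y * v 1 + z * v 2 = 0 ∧
      x * w 0 + y * w 1 + z * w 2 = 0 ∧ x * L 0 + y * L 1 + z * L 2 ≠ 0 := by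
  by_cases h : L ∈ Submodule.span ℚ {u, v, w}
  · left
    obtain ⟨α, β, γ, hL⟩ := Submodule.mem_span_triple.1 h
    exact ⟨α, β, γ, fun i => by rw [← hL]; simp⟩
  · right
    obtain ⟨φ, hφL, hφ⟩ := Submodule.exists_le_ker_of_notMem h
    have key : ∀ m : Fin 3 → ℚ, φ m =
        φ (Pi.single 0 1) * m 0 + φ (Pi.single 1 1) * m 1 + φ (Pi.single 2 1) * m 2 := by
      intro m
      conv_lhs => rw [LinearMap.pi_apply_eq_sum_univ φ m]
      simp only [Fin.sum_univ_three, smul_eq_mul]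
      have (i : Fin 3) : (fun j => if i = j then (1 : ℚ) else 0) = Pi.single i 1 := by
        ext j; simp [Pi.single_apply, eq_comm]
      simp only [this]
      ring
    refine ⟨_, _, _, (key u).symm.trans ?_, (key v).symm.trans ?_, (key w).symm.trans ?_,
      fun h0 => hφL ((key L).trans h0)⟩ <;>
    exact hφ (Submodule.subset_span (by simp))

theorem linearIndependent_subperiods_iff {p a b q c d r e f α β γ : ℚ} :
    LinearIndependent ℚ
        ![(![-a, -b, 0, p, 0, 0] : Fin 6 → ℚ), ![-c, 0, -d, 0, q, 0],
          ![0, -e, -f, 0, 0, r], ![0, 0, 0, α, β, γ]] ↔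
      ∀ x y z w : ℚ, a * x + c * y = 0 → b * x + e * z = 0 → d * y + f * z = 0 →
        p * x + α * w = 0 → q * y + β * w = 0 → r * z + γ * w = 0 →
        x = 0 ∧ y = 0 ∧ z = 0 ∧ w = 0 := by
  rw [Fintype.linearIndependent_iff]
  constructor
  · intro h x y z w h0 h1 h2 h3 h4 h5
    have := h ![x, y, z, w] (by
      ext i
      fin_cases i <;> simp [Fin.sum_univ_four] <;> linarith)
    exact ⟨this 0, this 1, this 2, this 3⟩
  · intro h g hg
    have e (i : Fin 6) := congrFun hg i
    have e0 := e 0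
    have e1 := e 1
    have e2 := e 2
    have e3 := e 3
    have e4 := e 4
    have e5 := e 5
    simp [Fin.sum_univ_four] at e0 e1 e2 e3 e4 e5
    obtain ⟨h0, h1, h2, h3⟩ := h (g 0) (g 1) (g 2) (g 3) (by linarith) (by linarith)
      (by linarith) (by linarith) (by linarith) (by linarith)
    intro i
    fin_cases i <;> assumption

theorem exists_subperiod_of_ne_zero {p q r : ℚ} (hp : p ≠ 0) (hq : q ≠ 0) (hr : r ≠ 0)
    {a b c d e f : ℚ} {k₁ k₂ k₃ k₄ k₅ : ℤ} {G : Fin 6 → ℝ} (hG2 : G 2 ≠ 0)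
    (hG : IsPluckerSolution p (p * a) (p * b) q (q * c) (q * d) r (r * e) (r * f)
      k₁ k₂ k₃ k₄ k₅ G)
    (hfin : NoSolutionCurve (IsPluckerSolution p (p * a) (p * b) q (q * c) (q * d)
      r (r * e) (r * f) k₁ k₂ k₃ k₄ k₅)) :
    ∃ α β γ : ℚ, (α : ℝ) * G 3 + (β : ℝ) * G 4 + (γ : ℝ) * G 5 = 0 ∧
      LinearIndependent ℚ
        ![(![-(p * a), -(p * b), 0, p, 0, 0] : Fin 6 → ℚ), ![-(q * c), 0, -(q * d), 0, q, 0],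
          ![0, -(r * e), -(r * f), 0, 0, r], ![0, 0, 0, α, β, γ]] := by
  have hpR : (p : ℝ) ≠ 0 := mod_cast hp
  have hqR : (q : ℝ) ≠ 0 := mod_cast hq
  have hrR : (r : ℝ) ≠ 0 := mod_cast hr
  have hsol (H : Fin 6 → ℝ) : IsPluckerSolution p (p * a) (p * b) q (q * c) (q * d)
      r (r * e) (r * f) k₁ k₂ k₃ k₄ k₅ H ↔
      H 3 = a * H 0 + b * H 1 ∧ H 4 = c * H 0 + d * H 2 ∧ H 5 = e * H 1 + f * H 2 ∧
      H 0 * H 5 = H 1 * H 4 - H 2 * H 3 ∧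
      (k₁ : ℝ) * H 0 * H 5 + (k₂ : ℝ) * H 1 * H 4 + (k₃ : ℝ) * H 2 * H 4
        + (k₄ : ℝ) * H 2 * H 5 + (k₅ : ℝ) * H 4 * H 5 = 0 := by
    unfold IsPluckerSolution
    push_cast
    simp only [mul_assoc, ← mul_add, mul_right_inj' hpR, mul_right_inj' hqR, mul_right_inj' hrR]
    tauto
  simp only [NoSolutionCurve, hsol] at hfin
  obtain ⟨h3, h4, h5, hF, hK⟩ := (hsol G).1 hG
  obtain ⟨A, hA⟩ : ∃ A, A = e - c := ⟨_, rfl⟩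
  obtain ⟨B, hB⟩ : ∃ B, B = f + a := ⟨_, rfl⟩
  obtain ⟨C, hC⟩ : ∃ C, C = b - d := ⟨_, rfl⟩
  obtain ⟨A', hA'⟩ : ∃ A', A' = k₁ * e + k₂ * c + k₅ * c * e := ⟨_, rfl⟩
  obtain ⟨B', hB'⟩ : ∃ B', B' = k₁ * f + k₃ * c + k₅ * c * f := ⟨_, rfl⟩
  obtain ⟨C', hC'⟩ : ∃ C', C' = k₂ * d + k₄ * e + k₅ * d * e := ⟨_, rfl⟩
  obtain ⟨D', hD'⟩ : ∃ D', D' = k₃ * d + k₄ * f + k₅ * d * f := ⟨_, rfl⟩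
  have cA : (A : ℝ) = e - c := by rw [hA]; push_cast; ring
  have cB : (B : ℝ) = f + a := by rw [hB]; push_cast; ring
  have cC : (C : ℝ) = b - d := by rw [hC]; push_cast; ring
  have cA' : (A' : ℝ) = k₁ * e + k₂ * c + k₅ * c * e := by rw [hA']; push_cast; ring
  have cB' : (B' : ℝ) = k₁ * f + k₃ * c + k₅ * c * f := by rw [hB']; push_cast; ring
  have cC' : (C' : ℝ) = k₂ * d + k₄ * e + k₅ * d * e := by rw [hC']; push_cast; ring
  have cD' : (D' : ℝ) = k₃ * d + k₄ * f + k₅ * d * f := by rw [hD']; push_cast; ring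
  have hAA' : ¬ (A = 0 ∧ A' = 0) := by
    rintro ⟨h, h'⟩
    rw [h, Rat.cast_zero] at cA
    rw [h', Rat.cast_zero] at cA'
    refine hfin 0 1 0 (fun s => ![s, 1, 0, a * s + b, c * s, e]) fun s _ => ?_
    simp
    exact ⟨by linear_combination -s * cA, by linear_combination -s * cA'⟩
  have hcurve (y : ℝ → ℝ) (s₀ : ℝ) (hy : ∀ s, s ≠ s₀ →
      A * (s * y s) + B * s + C * y s = 0 ∧
      A' * (s * y s) + B' * s + C' * y s + D' = 0) : False := by
    refine hfin 0 2 s₀ (fun s => ![s, y s, 1, a * s + b * y s, c * s + d, e * y s + f])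
      fun s hs => ?_
    obtain ⟨h1, h2⟩ := hy s hs
    rw [cA, cB, cC] at h1
    rw [cA', cB', cC', cD'] at h2
    simp
    exact ⟨by linear_combination h1, by linear_combination h2⟩
  have hL : ¬ (A * B' - A' * B = 0 ∧ A * C' - A' * C = 0 ∧ A * D' = 0) := by
    rintro ⟨h1, h2, h3⟩
    have h1R : (A : ℝ) * B' - A' * B = 0 := mod_cast h1
    have h2R : (A : ℝ) * C' - A' * C = 0 := mod_cast h2
    have h3R : (A : ℝ) * D' = 0 := mod_cast h3
    by_cases hA0 : A = 0
    · have hA'0 : A' ≠ 0 := fun h => hAA' ⟨hA0, h⟩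
      have hA'R : (A' : ℝ) ≠ 0 := mod_cast hA'0
      have hB0 : B = 0 := by simpa [hA0, hA'0] using h1
      have hC0 : C = 0 := by simpa [hA0, hA'0] using h2
      refine hcurve (fun s => -(B' * s + D') / (A' * s + C')) (-C' / A') fun s hs => ?_
      have hne : (A' : ℝ) * s + C' ≠ 0 := fun h => hs (by field_simp; linarith)
      refine ⟨by simp [hA0, hB0, hC0], by field_simp; ring⟩
    · have hAR : (A : ℝ) ≠ 0 := mod_cast hA0
      have hD0 : (D' : ℝ) = 0 := by simpa [hAR] using h3R
      refine hcurve (fun s => -(B * s) / (A * s + C)) (-C / A) fun s hs => ?_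
      have hne : (A : ℝ) * s + C ≠ 0 := fun h => hs (by field_simp; linarith)
      have h1' : A * (s * (-(B * s) / (A * s + C))) + B * s + C * (-(B * s) / (A * s + C)) = 0 := by
        field_simp; ring
      refine ⟨h1', mul_left_cancel₀ hAR ?_⟩
      generalize -(B * s) / (A * s + C : ℝ) = t at *
      linear_combination A' * h1' + s * h1R + t * h2R + h3R
  have hrel : ((A * B' - A' * B : ℚ) : ℝ) * G 0 + ((A * C' - A' * C : ℚ) : ℝ) * G 1
      + ((A * D' : ℚ) : ℝ) * G 2 = 0 := by
    refine mul_left_cancel₀ hG2 ?_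
    rw [h3, h4, h5] at hF
    rw [h4, h5] at hK
    push_cast
    have h1 : A * (G 0 * G 1) + B * (G 0 * G 2) + C * (G 1 * G 2) = 0 := by
      rw [cA, cB, cC]; linear_combination hF
    have h2 : A' * (G 0 * G 1) + B' * (G 0 * G 2) + C' * (G 1 * G 2) + D' * G 2 ^ 2 = 0 := by
      rw [cA', cB', cC', cD']; linear_combination hK
    linear_combination A * h2 - A' * h1
  obtain ⟨α, β, γ, h⟩ | ⟨x, y, z, hu, hv, hw, h⟩ := exists_combination_or_exists_orthogonal
    ![a, b, 0] ![c, 0, d] ![0, e, f] ![A * B' - A' * B, A * C' - A' * C, A * D']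
  · have e0 := h 0
    have e1 := h 1
    have e2 := h 2
    simp at e0 e1 e2
    rw [e0, e1, e2] at hrel
    refine ⟨α, β, γ, ?_, ?_⟩
    · rw [h3, h4, h5]
      push_cast at hrel
      linear_combination hrel
    · rw [linearIndependent_subperiods_iff]
      intro x y z w g0 g1 g2 g3 g4 g5
      have hw : w = 0 := by
        by_contra hw
        refine hL ⟨?_, ?_, ?_⟩ <;> refine mul_left_cancel₀ hw ?_
        · rw [e0]; linear_combination a * g3 + c * g4 - g0
        · rw [e1]; linear_combination b * g3 + e * g5 - g1
        · rw [e2]; linear_combination d * g4 + f * g5 - g2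
      exact ⟨by simpa [hw, hp] using g3, by simpa [hw, hq] using g4, by simpa [hw, hr] using g5, hw⟩
  · exfalso
    simp at hu hv hw h
    have t1 : A * (x * y) + B * (x * z) + C * (y * z) = 0 := by
      rw [hA, hB, hC]; linear_combination x * hw - y * hv + z * hu
    have t2 : A' * (x * y) + B' * (x * z) + C' * (y * z) + D' * z ^ 2 = 0 := by
      rw [hA', hB', hC', hD']
      linear_combination k₁ * x * hw + k₂ * y * hv + k₃ * z * hv + k₄ * z * hw
        + k₅ * (x * c + z * d) * hw
    have hz : z = 0 := by
      refine (mul_eq_zero.1 ?_).resolve_right h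
      linear_combination A * t2 - A' * t1
    subst hz
    have hxy : x * y = 0 := by
      by_contra hxy
      exact hAA' ⟨by simpa [hxy] using t1, by simpa [hxy] using t2⟩
    rcases mul_eq_zero.1 hxy with rfl | rfl
    · have hy : y ≠ 0 := by rintro rfl; simp at h
      have hb : b = 0 := by simpa [hy] using hu
      have he : e = 0 := by simpa [hy] using hw
      apply h
      rw [hA, hC, hA', hC', hb, he]; ring
    · have hx : x ≠ 0 := by rintro rfl; simp at h
      have ha : a = 0 := by simpa [hx] using hu
      have hc : c = 0 := by simpa [hx] using hv
      apply h
      rw [hA, hB, hA', hB', ha, hc]; ring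

theorem exists_subperiod_of_ratio_G13_G12 {q r b : ℚ} (hb : b ≠ 0) (hq : q ≠ 0) (hr : r ≠ 0)
    {κ c d e f : ℚ} {k₁ k₂ k₃ k₄ k₅ : ℤ} {G : Fin 6 → ℝ} (hG2 : G 2 ≠ 0)
    (hG : IsPluckerSolution 0 (b * -κ) b q (q * c) (q * d) r (r * e) (r * f) k₁ k₂ k₃ k₄ k₅ G)
    (hfin : NoSolutionCurve (IsPluckerSolution 0 (b * -κ) b q (q * c) (q * d)
      r (r * e) (r * f) k₁ k₂ k₃ k₄ k₅)) :
    ∃ α β γ : ℚ, (α : ℝ) * G 3 + (β : ℝ) * G 4 + (γ : ℝ) * G 5 = 0 ∧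
      LinearIndependent ℚ
        ![(![-(b * -κ), -b, 0, 0, 0, 0] : Fin 6 → ℚ), ![-(q * c), 0, -(q * d), 0, q, 0],
          ![0, -(r * e), -(r * f), 0, 0, r], ![0, 0, 0, α, β, γ]] := by
  have hbR : (b : ℝ) ≠ 0 := mod_cast hb
  have hqR : (q : ℝ) ≠ 0 := mod_cast hq
  have hrR : (r : ℝ) ≠ 0 := mod_cast hr
  have hsol (H : Fin 6 → ℝ) : IsPluckerSolution 0 (b * -κ) b q (q * c) (q * d)
      r (r * e) (r * f) k₁ k₂ k₃ k₄ k₅ H ↔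
      H 1 = κ * H 0 ∧ H 4 = c * H 0 + d * H 2 ∧ H 5 = e * H 1 + f * H 2 ∧
      H 0 * H 5 = H 1 * H 4 - H 2 * H 3 ∧
      (k₁ : ℝ) * H 0 * H 5 + (k₂ : ℝ) * H 1 * H 4 + (k₃ : ℝ) * H 2 * H 4
        + (k₄ : ℝ) * H 2 * H 5 + (k₅ : ℝ) * H 4 * H 5 = 0 := by
    have h1 : (0 : ℝ) = -κ * H 0 + H 1 ↔ H 1 = κ * H 0 :=
      ⟨fun h => by linarith, fun h => by linarith⟩
    unfold IsPluckerSolution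
    push_cast
    rw [zero_mul, ← mul_zero (b : ℝ)]
    simp only [mul_assoc, ← mul_add, mul_right_inj' hbR, mul_right_inj' hqR, mul_right_inj' hrR,
      h1]
    tauto
  simp only [NoSolutionCurve, hsol] at hfin
  obtain ⟨h1, h4, h5, hF, hK⟩ := (hsol G).1 hG
  obtain ⟨A, hA⟩ : ∃ A, A = κ * (e - c) := ⟨_, rfl⟩
  obtain ⟨B, hB⟩ : ∃ B, B = f - κ * d := ⟨_, rfl⟩
  obtain ⟨A', hA'⟩ : ∃ A', A' = k₁ * κ * e + k₂ * κ * c + k₅ * c * κ * e := ⟨_, rfl⟩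
  obtain ⟨B', hB'⟩ : ∃ B', B' = k₁ * f + k₂ * κ * d + k₃ * c + k₄ * e * κ
    + k₅ * (c * f + d * e * κ) := ⟨_, rfl⟩
  obtain ⟨C', hC'⟩ : ∃ C', C' = k₃ * d + k₄ * f + k₅ * d * f := ⟨_, rfl⟩
  have cA : (A : ℝ) = κ * (e - c) := by rw [hA]; push_cast; ring
  have cB : (B : ℝ) = f - κ * d := by rw [hB]; push_cast; ring
  have cA' : (A' : ℝ) = k₁ * κ * e + k₂ * κ * c + k₅ * c * κ * e := by
    rw [hA']; push_cast; ring
  have cB' : (B' : ℝ) = k₁ * f + k₂ * κ * d + k₃ * c + k₄ * e * κ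
    + k₅ * (c * f + d * e * κ) := by rw [hB']; push_cast; ring
  have cC' : (C' : ℝ) = k₃ * d + k₄ * f + k₅ * d * f := by rw [hC']; push_cast; ring
  have hAA' : ¬ (A = 0 ∧ A' = 0) := by
    rintro ⟨h, h'⟩
    rw [h, Rat.cast_zero] at cA
    rw [h', Rat.cast_zero] at cA'
    refine hfin 3 0 0 (fun s => ![1, κ, 0, s, c, e * κ]) fun s _ => ?_
    simp
    exact ⟨by linear_combination -cA, by linear_combination -cA'⟩
  have hL : ¬ (A * B' - A' * B = 0 ∧ A * C' = 0 ∧ A' = 0) := by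
    rintro ⟨hx, hz, hw⟩
    have hA0 : A ≠ 0 := fun h => hAA' ⟨h, hw⟩
    have hB0 : B' = 0 := by simpa [hw, hA0] using hx
    have hC0 : C' = 0 := by simpa [hA0] using hz
    rw [hB0, Rat.cast_zero] at cB'
    rw [hC0, Rat.cast_zero] at cC'
    rw [hw, Rat.cast_zero] at cA'
    refine hfin 0 2 0 (fun s => ![s, κ * s, 1, -(A * s ^ 2 + B * s), c * s + d,
      e * (κ * s) + f]) fun s _ => ?_
    simp
    exact ⟨by rw [cA, cB]; ring, by linear_combination -s ^ 2 * cA' - s * cB' - cC'⟩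
  have hrel : ((A * B' - A' * B : ℚ) : ℝ) * G 0 + ((A * C' : ℚ) : ℝ) * G 2
      + ((-A' : ℚ) : ℝ) * G 3 = 0 := by
    refine mul_left_cancel₀ hG2 ?_
    rw [h4, h5, h1] at hF
    rw [h4, h5, h1] at hK
    push_cast
    have t1 : A * G 0 ^ 2 + B * (G 0 * G 2) + G 2 * G 3 = 0 := by
      rw [cA, cB]; linear_combination hF
    have t2 : A' * G 0 ^ 2 + B' * (G 0 * G 2) + C' * G 2 ^ 2 = 0 := by
      rw [cA', cB', cC']; linear_combination hK
    linear_combination A * t2 - A' * t1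
  obtain ⟨α, β, γ, h⟩ | ⟨x, z, w, hu, hv, hw, h⟩ := exists_combination_or_exists_orthogonal
    ![0, 0, 1] ![c, d, 0] ![e * κ, f, 0] ![A * B' - A' * B, A * C', -A']
  · have e0 := h 0
    have e1 := h 1
    have e2 := h 2
    simp at e0 e1 e2
    rw [e0, e1, e2] at hrel
    refine ⟨α, β, γ, ?_, ?_⟩
    · rw [h4, h5, h1]
      push_cast at hrel
      linear_combination hrel
    · rw [linearIndependent_subperiods_iff]
      intro x y z w g0 g1 g2 g3 g4 g5
      have hw : w = 0 := by
        by_contra hw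
        refine hL ⟨?_, ?_, ?_⟩ <;> refine mul_left_cancel₀ hw ?_
        · rw [e0]; linear_combination c * g4 + e * κ * g5 - g0 - κ * g1
        · rw [e1]; linear_combination d * g4 + f * g5 - g2
        · linear_combination -w * e2 - g3
      have hy : y = 0 := by simpa [hw, hq] using g4
      have hz : z = 0 := by simpa [hw, hr] using g5
      have hx : x = 0 := by simpa [hz, hb] using g1
      exact ⟨hx, hy, hz, hw⟩
  · simp at hu hv hw h
    subst hu
    have t1 : A * x ^ 2 + B * (x * z) = 0 := by
      rw [hA, hB]; linear_combination x * hw - κ * x * hv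
    have t2 : A' * x ^ 2 + B' * (x * z) + C' * z ^ 2 = 0 := by
      rw [hA', hB', hC']
      linear_combination k₁ * x * hw + k₂ * κ * x * hv + k₃ * z * hv + k₄ * z * hw
        + k₅ * (x * c + z * d) * hw
    have hz : z = 0 := by
      refine (mul_eq_zero.1 ?_).resolve_right h
      linear_combination A * t2 - A' * t1
    subst hz
    have hx : x ≠ 0 := by rintro rfl; simp at h
    exact (hAA' ⟨by simpa [hx] using t1, by simpa [hx] using t2⟩).elim

theorem exists_subperiod_of_ratio_G14_G12 {p r d : ℚ} (hp : p ≠ 0) (hd : d ≠ 0) (hr : r ≠ 0)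
    {κ a b e f : ℚ} {k₁ k₂ k₃ k₄ k₅ : ℤ} {G : Fin 6 → ℝ} (hG0 : G 0 ≠ 0)
    (hG : IsPluckerSolution p (p * a) (p * b) 0 (d * -κ) d r (r * e) (r * f) k₁ k₂ k₃ k₄ k₅ G)
    (hfin : NoSolutionCurve (IsPluckerSolution p (p * a) (p * b) 0 (d * -κ) d
      r (r * e) (r * f) k₁ k₂ k₃ k₄ k₅)) :
    ∃ α β γ : ℚ, (α : ℝ) * G 3 + (β : ℝ) * G 4 + (γ : ℝ) * G 5 = 0 ∧
      LinearIndependent ℚ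
        ![(![-(p * a), -(p * b), 0, p, 0, 0] : Fin 6 → ℚ), ![-(d * -κ), 0, -d, 0, 0, 0],
          ![0, -(r * e), -(r * f), 0, 0, r], ![0, 0, 0, α, β, γ]] := by
  have hpR : (p : ℝ) ≠ 0 := mod_cast hp
  have hdR : (d : ℝ) ≠ 0 := mod_cast hd
  have hrR : (r : ℝ) ≠ 0 := mod_cast hr
  have hsol (H : Fin 6 → ℝ) : IsPluckerSolution p (p * a) (p * b) 0 (d * -κ) d
      r (r * e) (r * f) k₁ k₂ k₃ k₄ k₅ H ↔
      H 3 = a * H 0 + b * H 1 ∧ H 2 = κ * H 0 ∧ H 5 = e * H 1 + f * H 2 ∧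
      H 0 * H 5 = H 1 * H 4 - H 2 * H 3 ∧
      (k₁ : ℝ) * H 0 * H 5 + (k₂ : ℝ) * H 1 * H 4 + (k₃ : ℝ) * H 2 * H 4
        + (k₄ : ℝ) * H 2 * H 5 + (k₅ : ℝ) * H 4 * H 5 = 0 := by
    have h2 : (0 : ℝ) = -κ * H 0 + H 2 ↔ H 2 = κ * H 0 :=
      ⟨fun h => by linarith, fun h => by linarith⟩
    unfold IsPluckerSolution
    push_cast
    rw [zero_mul, ← mul_zero (d : ℝ)]
    simp only [mul_assoc, ← mul_add, mul_right_inj' hpR, mul_right_inj' hdR, mul_right_inj' hrR,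
      h2]
    tauto
  simp only [NoSolutionCurve, hsol] at hfin
  obtain ⟨h3, h2, h5, hF, hK⟩ := (hsol G).1 hG
  obtain ⟨A, hA⟩ : ∃ A, A = k₂ + k₅ * e := ⟨_, rfl⟩
  obtain ⟨X, hX⟩ : ∃ X, X = κ * f * (k₁ + k₄ * κ) + A * κ * (f + a) := ⟨_, rfl⟩
  obtain ⟨Y, hY⟩ : ∃ Y, Y = e * (k₁ + k₄ * κ) + A * (e + κ * b) := ⟨_, rfl⟩
  obtain ⟨W, hW⟩ : ∃ W, W = κ * (k₃ + k₅ * f) := ⟨_, rfl⟩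
  have cA : (A : ℝ) = k₂ + k₅ * e := by rw [hA]; push_cast; ring
  have cX : (X : ℝ) = κ * f * (k₁ + k₄ * κ) + A * κ * (f + a) := by rw [hX]; push_cast; ring
  have cY : (Y : ℝ) = e * (k₁ + k₄ * κ) + A * (e + κ * b) := by rw [hY]; push_cast; ring
  have cW : (W : ℝ) = κ * (k₃ + k₅ * f) := by rw [hW]; push_cast; ring
  rw [cA] at cX cY
  have hL : ¬ (X = 0 ∧ Y = 0 ∧ W = 0) := by
    rintro ⟨hx, hy, hw⟩
    rw [hx, Rat.cast_zero] at cX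
    rw [hy, Rat.cast_zero] at cY
    rw [hw, Rat.cast_zero] at cW
    refine hfin 1 0 0 (fun s => ![1, s, κ, a + b * s, ((e + κ * b) * s + κ * (f + a)) / s,
      e * s + f * κ]) fun s hs => ?_
    have hw : s * (((e + κ * b) * s + κ * (f + a)) / s) = (e + κ * b) * s + κ * (f + a) := by
      field_simp
    simp
    generalize ((e + κ * b) * s + κ * (f + a)) / s = w at *
    exact ⟨by linear_combination -hw,
      by linear_combination (k₂ + k₅ * e) * hw - cX - s * cY - w * cW⟩
  have hrel : (X : ℝ) * G 0 + (Y : ℝ) * G 1 + (W : ℝ) * G 4 = 0 := by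
    refine mul_left_cancel₀ hG0 ?_
    rw [h5, h3, h2] at hF
    rw [h5, h2] at hK
    rw [cX, cY, cW]
    linear_combination hK + (k₂ + k₅ * e) * hF
  obtain ⟨α, β, γ, h⟩ | ⟨x, y, w, hu, hv, hw, h⟩ := exists_combination_or_exists_orthogonal
    ![a, b, 0] ![0, 0, 1] ![f * κ, e, 0] ![X, Y, W]
  · have e0 := h 0
    have e1 := h 1
    have e2 := h 2
    simp at e0 e1 e2
    rw [e0, e1, e2] at hrel
    refine ⟨α, β, γ, ?_, ?_⟩
    · rw [h5, h3, h2]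
      push_cast at hrel
      linear_combination hrel
    · rw [linearIndependent_subperiods_iff]
      intro x y z w g0 g1 g2 g3 g4 g5
      have hw : w = 0 := by
        by_contra hw
        refine hL ⟨?_, ?_, ?_⟩ <;> refine mul_left_cancel₀ hw ?_
        · rw [e0]; linear_combination a * g3 + f * κ * g5 - g0 - κ * g2
        · rw [e1]; linear_combination b * g3 + e * g5 - g1
        · linear_combination w * e2 + g4
      have hx : x = 0 := by simpa [hw, hp] using g3
      have hz : z = 0 := by simpa [hw, hr] using g5
      have hy : y = 0 := by simpa [hz, hd] using g2
      exact ⟨hx, hy, hz, hw⟩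
  · exfalso
    simp at hu hv hw h
    subst hv
    have hx : x = 0 := by
      refine (mul_eq_zero.1 ?_).resolve_right h
      rw [hX, hY]
      linear_combination x * (k₁ + k₄ * κ + A) * hw + A * κ * x * hu
    subst hx
    simp at hu hw h
    have hb : b = 0 := by simpa [h.1] using hu
    have he : e = 0 := by simpa [h.1] using hw
    exact h.2 (by rw [hY, hb, he]; ring)

theorem exists_subperiod_of_ratio_G14_G13 {p q f : ℚ} (hp : p ≠ 0) (hq : q ≠ 0) (hf : f ≠ 0)
    {κ a b c d : ℚ} {k₁ k₂ k₃ k₄ k₅ : ℤ} {G : Fin 6 → ℝ} (hG1 : G 1 ≠ 0)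
    (hG : IsPluckerSolution p (p * a) (p * b) q (q * c) (q * d) 0 (f * -κ) f k₁ k₂ k₃ k₄ k₅ G)
    (hfin : NoSolutionCurve (IsPluckerSolution p (p * a) (p * b) q (q * c) (q * d)
      0 (f * -κ) f k₁ k₂ k₃ k₄ k₅)) :
    ∃ α β γ : ℚ, (α : ℝ) * G 3 + (β : ℝ) * G 4 + (γ : ℝ) * G 5 = 0 ∧
      LinearIndependent ℚ
        ![(![-(p * a), -(p * b), 0, p, 0, 0] : Fin 6 → ℚ), ![-(q * c), 0, -(q * d), 0, q, 0],
          ![0, -(f * -κ), -f, 0, 0, 0], ![0, 0, 0, α, β, γ]] := by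
  have hpR : (p : ℝ) ≠ 0 := mod_cast hp
  have hqR : (q : ℝ) ≠ 0 := mod_cast hq
  have hfR : (f : ℝ) ≠ 0 := mod_cast hf
  have hsol (H : Fin 6 → ℝ) : IsPluckerSolution p (p * a) (p * b) q (q * c) (q * d)
      0 (f * -κ) f k₁ k₂ k₃ k₄ k₅ H ↔
      H 3 = a * H 0 + b * H 1 ∧ H 4 = c * H 0 + d * H 2 ∧ H 2 = κ * H 1 ∧
      H 0 * H 5 = H 1 * H 4 - H 2 * H 3 ∧
      (k₁ : ℝ) * H 0 * H 5 + (k₂ : ℝ) * H 1 * H 4 + (k₃ : ℝ) * H 2 * H 4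
        + (k₄ : ℝ) * H 2 * H 5 + (k₅ : ℝ) * H 4 * H 5 = 0 := by
    have h2 : (0 : ℝ) = -κ * H 1 + H 2 ↔ H 2 = κ * H 1 :=
      ⟨fun h => by linarith, fun h => by linarith⟩
    unfold IsPluckerSolution
    push_cast
    rw [zero_mul, ← mul_zero (f : ℝ)]
    simp only [mul_assoc, ← mul_add, mul_right_inj' hpR, mul_right_inj' hqR, mul_right_inj' hfR,
      h2]
    tauto
  simp only [NoSolutionCurve, hsol] at hfin
  obtain ⟨h3, h4, h2, hF, hK⟩ := (hsol G).1 hG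
  obtain ⟨A, hA⟩ : ∃ A, A = k₁ + k₅ * c := ⟨_, rfl⟩
  obtain ⟨X, hX⟩ : ∃ X, X = c * (k₂ + k₃ * κ) - A * (κ * a - c) := ⟨_, rfl⟩
  obtain ⟨Y, hY⟩ : ∃ Y, Y = d * κ * (k₂ + k₃ * κ) - A * κ * (b - d) := ⟨_, rfl⟩
  obtain ⟨W, hW⟩ : ∃ W, W = κ * (k₄ + k₅ * d) := ⟨_, rfl⟩
  have cA : (A : ℝ) = k₁ + k₅ * c := by rw [hA]; push_cast; ring
  have cX : (X : ℝ) = c * (k₂ + k₃ * κ) - A * (κ * a - c) := by rw [hX]; push_cast; ring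
  have cY : (Y : ℝ) = d * κ * (k₂ + k₃ * κ) - A * κ * (b - d) := by rw [hY]; push_cast; ring
  have cW : (W : ℝ) = κ * (k₄ + k₅ * d) := by rw [hW]; push_cast; ring
  rw [cA] at cX cY
  have hL : ¬ (X = 0 ∧ Y = 0 ∧ W = 0) := by
    rintro ⟨hx, hy, hw⟩
    rw [hx, Rat.cast_zero] at cX
    rw [hy, Rat.cast_zero] at cY
    rw [hw, Rat.cast_zero] at cW
    refine hfin 0 1 0 (fun s => ![s, 1, κ, a * s + b, c * s + d * κ,
      ((c - κ * a) * s + κ * (d - b)) / s]) fun s hs => ?_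
    have hw : s * (((c - κ * a) * s + κ * (d - b)) / s) = (c - κ * a) * s + κ * (d - b) := by
      field_simp
    simp
    generalize ((c - κ * a) * s + κ * (d - b)) / s = w at *
    exact ⟨by linear_combination hw,
      by linear_combination (k₁ + k₅ * c) * hw - s * cX - cY - w * cW⟩
  have hrel : (X : ℝ) * G 0 + (Y : ℝ) * G 1 + (W : ℝ) * G 5 = 0 := by
    refine mul_left_cancel₀ hG1 ?_
    rw [h4, h3, h2] at hF
    rw [h4, h2] at hK
    rw [cX, cY, cW]
    linear_combination hK - (k₁ + k₅ * c) * hF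
  obtain ⟨α, β, γ, h⟩ | ⟨x, y, w, hu, hv, hw, h⟩ := exists_combination_or_exists_orthogonal
    ![a, b, 0] ![c, d * κ, 0] ![0, 0, 1] ![X, Y, W]
  · have e0 := h 0
    have e1 := h 1
    have e2 := h 2
    simp at e0 e1 e2
    rw [e0, e1, e2] at hrel
    refine ⟨α, β, γ, ?_, ?_⟩
    · rw [h4, h3, h2]
      push_cast at hrel
      linear_combination hrel
    · rw [linearIndependent_subperiods_iff]
      intro x y z w g0 g1 g2 g3 g4 g5
      have hw : w = 0 := by
        by_contra hw
        refine hL ⟨?_, ?_, ?_⟩ <;> refine mul_left_cancel₀ hw ?_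
        · rw [e0]; linear_combination a * g3 + c * g4 - g0
        · rw [e1]; linear_combination b * g3 + d * κ * g4 - g1 - κ * g2
        · linear_combination w * e2 + g5
      have hx : x = 0 := by simpa [hw, hp] using g3
      have hy : y = 0 := by simpa [hw, hq] using g4
      have hz : z = 0 := by simpa [hy, hf] using g2
      exact ⟨hx, hy, hz, hw⟩
  · exfalso
    simp at hu hv hw h
    subst hw
    have hy : y = 0 := by
      refine (mul_eq_zero.1 ?_).resolve_right h
      rw [hX, hY]
      linear_combination y * (k₂ + k₃ * κ + A) * hv - A * κ * y * hu
    subst hy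
    simp at hu hv h
    have ha : a = 0 := by simpa [h.1] using hu
    have hc : c = 0 := by simpa [h.1] using hv
    exact h.2 (by rw [hX, ha, hc]; ring)

theorem exists_ratio_of_relation {m n : ℚ} {x y : ℝ} (hx : x ≠ 0) (hmn : ¬ (m = 0 ∧ n = 0))
    (h : 0 = (m : ℝ) * x + (n : ℝ) * y) : n ≠ 0 ∧ ∃ κ : ℚ, m = n * -κ ∧ y = κ * x := by
  have hn : n ≠ 0 := by
    rintro rfl
    simp [hx] at h
    exact hmn ⟨h, rfl⟩
  have hnR : (n : ℝ) ≠ 0 := mod_cast hn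
  refine ⟨hn, -m / n, by field_simp, ?_⟩
  push_cast
  field_simp
  linarith

/-- case A of Lemma "fourth subperiod": under the same hypotheses
as in STATEMENT 10, the plane also has a subperiod of type 1, whose coefficient
vector in `ℚ⁶` is linearly independent from those of the three given subperiods
(coordinates ordered as `G12, G13, G14, G23, G24, G34`). -/
theorem stmt_11 (u v : Fin 4 → ℝ)
    (hindep : LinearIndependent ℝ ![u, v])
    (G : Fin 4 → Fin 4 → ℝ)
    (hG : ∀ i j, G i j = u i * v j - u j * v i)
    (hnondeg : G 0 1 ≠ 0 ∧ G 0 2 ≠ 0 ∧ G 0 3 ≠ 0 ∧ G 1 2 ≠ 0 ∧ G 1 3 ≠ 0 ∧ G 2 3 ≠ 0)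
    (hirr : ∀ w : Fin 4 → ℝ, w ∈ Submodule.span ℝ ({u, v} : Set (Fin 4 → ℝ)) →
      (∀ i, ∃ q : ℚ, w i = (q : ℝ)) → w = 0)
    (p a b q c d r e f : ℚ)
    (hpne : (p, a, b) ≠ (0, 0, 0)) (hqne : (q, c, d) ≠ (0, 0, 0))
    (hrne : (r, e, f) ≠ (0, 0, 0))
    (hsp4 : (p : ℝ) * G 1 2 = (a : ℝ) * G 0 1 + (b : ℝ) * G 0 2)
    (hsp3 : (q : ℝ) * G 1 3 = (c : ℝ) * G 0 1 + (d : ℝ) * G 0 3)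
    (hsp2 : (r : ℝ) * G 2 3 = (e : ℝ) * G 0 2 + (f : ℝ) * G 0 3)
    (k₁ k₂ k₃ k₄ k₅ : ℤ)
    (hco : (k₁ : ℝ) * G 0 1 * G 2 3 + (k₂ : ℝ) * G 0 2 * G 1 3 + (k₃ : ℝ) * G 0 3 * G 1 3
      + (k₄ : ℝ) * G 0 3 * G 2 3 + (k₅ : ℝ) * G 1 3 * G 2 3 = 0)
    (hfin : Set.Finite {L : Submodule ℝ (Fin 6 → ℝ) | ∃ H : Fin 6 → ℝ, H ≠ 0 ∧
      L = Submodule.span ℝ {H} ∧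
      H 0 * H 5 = H 1 * H 4 - H 2 * H 3 ∧
      (p : ℝ) * H 3 = (a : ℝ) * H 0 + (b : ℝ) * H 1 ∧
      (q : ℝ) * H 4 = (c : ℝ) * H 0 + (d : ℝ) * H 2 ∧
      (r : ℝ) * H 5 = (e : ℝ) * H 1 + (f : ℝ) * H 2 ∧
      (k₁ : ℝ) * H 0 * H 5 + (k₂ : ℝ) * H 1 * H 4 + (k₃ : ℝ) * H 2 * H 4
        + (k₄ : ℝ) * H 2 * H 5 + (k₅ : ℝ) * H 4 * H 5 = 0}) :
    ∃ α β γ : ℚ, (α, β, γ) ≠ (0, 0, 0) ∧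
      (α : ℝ) * G 1 2 + (β : ℝ) * G 1 3 + (γ : ℝ) * G 2 3 = 0 ∧
      LinearIndependent ℚ
        ![(![-a, -b, 0, p, 0, 0] : Fin 6 → ℚ),
          ![-c, 0, -d, 0, q, 0],
          ![0, -e, -f, 0, 0, r],
          ![0, 0, 0, α, β, γ]] := by
  obtain ⟨h01, h02, h03, -, -, -⟩ := hnondeg
  have hirr' (m n : ℚ) (hm : G 0 2 = m * G 0 1) (hn : G 0 3 = n * G 0 1) : False := by
    have hw := hirr ((G 0 1)⁻¹ • (u 0 • v - v 0 • u))
      (Submodule.smul_mem _ _ (Submodule.sub_mem _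
        (Submodule.smul_mem _ _ (Submodule.subset_span (by simp)))
        (Submodule.smul_mem _ _ (Submodule.subset_span (by simp)))))
    have hval (i : Fin 4) : ((G 0 1)⁻¹ • (u 0 • v - v 0 • u)) i = (G 0 1)⁻¹ * G 0 i := by
      simp only [hG, Pi.smul_apply, Pi.sub_apply, smul_eq_mul]
      ring
    have hz := congrFun (hw fun i => ?_) 1
    · rw [hval, inv_mul_cancel₀ h01] at hz
      exact one_ne_zero hz
    · rw [hval]
      fin_cases i
      · exact ⟨0, by simp [hG]⟩
      · exact ⟨1, by simp [h01]⟩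
      · exact ⟨m, by simp [hm, h01, mul_comm]⟩
      · exact ⟨n, by simp [hn, h01, mul_comm]⟩
  have hfin' := noSolutionCurve_of_finite
    (P := IsPluckerSolution p a b q c d r e f k₁ k₂ k₃ k₄ k₅) hfin
  have hsol : IsPluckerSolution p a b q c d r e f k₁ k₂ k₃ k₄ k₅
      ![G 0 1, G 0 2, G 0 3, G 1 2, G 1 3, G 2 3] :=
    ⟨by simp [hG]; ring, hsp4, hsp3, hsp2, hco⟩
  clear hfin
  suffices h : ∃ α β γ : ℚ, (α : ℝ) * G 1 2 + (β : ℝ) * G 1 3 + (γ : ℝ) * G 2 3 = 0 ∧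
      LinearIndependent ℚ
        ![(![-a, -b, 0, p, 0, 0] : Fin 6 → ℚ), ![-c, 0, -d, 0, q, 0],
          ![0, -e, -f, 0, 0, r], ![0, 0, 0, α, β, γ]] by
    obtain ⟨α, β, γ, h1, h2⟩ := h
    refine ⟨α, β, γ, fun h0 => h2.ne_zero 3 ?_, h1, h2⟩
    simp only [Prod.mk.injEq] at h0
    ext i
    fin_cases i <;> simp [h0]
  have normalize {s : ℚ} (hs : s ≠ 0) (t : ℚ) : ∃ t', t = s * t' := ⟨t / s, by field_simp⟩
  have ratio4 (hp : p = 0) := exists_ratio_of_relation (m := a) (n := b) h01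
    (by simpa [hp] using hpne) (by simpa [hp] using hsp4)
  have ratio3 (hq : q = 0) := exists_ratio_of_relation (m := c) (n := d) h01
    (by simpa [hq] using hqne) (by simpa [hq] using hsp3)
  have ratio2 (hr : r = 0) := exists_ratio_of_relation (m := e) (n := f) h02
    (by simpa [hr] using hrne) (by simpa [hr] using hsp2)
  by_cases hp : p = 0
  · obtain ⟨hb, κ, rfl, hκ⟩ := ratio4 hp
    have hq : q ≠ 0 := fun hq => by
      obtain ⟨-, κ', -, hκ'⟩ := ratio3 hq
      exact hirr' κ κ' hκ hκ'
    have hr : r ≠ 0 := fun hr => by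
      obtain ⟨-, κ', -, hκ'⟩ := ratio2 hr
      exact hirr' κ (κ' * κ) hκ (by rw [hκ', hκ]; push_cast; ring)
    obtain ⟨c, rfl⟩ := normalize hq c
    obtain ⟨d, rfl⟩ := normalize hq d
    obtain ⟨e, rfl⟩ := normalize hr e
    obtain ⟨f, rfl⟩ := normalize hr f
    subst hp
    exact exists_subperiod_of_ratio_G13_G12 hb hq hr h03 hsol hfin'
  obtain ⟨a, rfl⟩ := normalize hp a
  obtain ⟨b, rfl⟩ := normalize hp b
  by_cases hq : q = 0
  · obtain ⟨hd, κ, rfl, hκ⟩ := ratio3 hq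
    have hr : r ≠ 0 := fun hr => by
      obtain ⟨-, κ', -, hκ'⟩ := ratio2 hr
      have hne : (κ' : ℝ) ≠ 0 := fun h => h03 (by rw [hκ', h, zero_mul])
      refine hirr' (κ / κ') κ ?_ hκ
      push_cast
      field_simp
      linarith
    obtain ⟨e, rfl⟩ := normalize hr e
    obtain ⟨f, rfl⟩ := normalize hr f
    subst hq
    exact exists_subperiod_of_ratio_G14_G12 hp hd hr h01 hsol hfin'
  obtain ⟨c, rfl⟩ := normalize hq c
  obtain ⟨d, rfl⟩ := normalize hq d
  by_cases hr : r = 0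
  · obtain ⟨hf, κ, rfl, hκ⟩ := ratio2 hr
    subst hr
    exact exists_subperiod_of_ratio_G14_G13 hp hq hf h02 hsol hfin'
  obtain ⟨e, rfl⟩ := normalize hr e
  obtain ⟨f, rfl⟩ := normalize hr f
  exact exists_subperiod_of_ne_zero hp hq hr h03 hsol hfin'
end

section
/- Let u, v ∈ ℝ⁴ be linearly independent, E = span{u, v}, and suppose E is nondegenerate. Suppose there are nonzero rational triples (p,a,b), (q,c,d), (r,e,f) with p·G23 = a·G24 + b·G34 (subperiod of type 1), q·G12 = c·G14 + d·G24 (subperiod of type 3), r·G13 = e·G14 + f·G34 (subperiod of type 2), and integers k₁, …, k₅ with k₁·G12·G34 + k₂·G13·G24 + k₃·G14·G24 + k₄·G14·G34 + k₅·G24·G34 = 0 (a coincidence equation), such that the set of one-dimensional subspaces ℝ·H of ℝ⁶ of nonzero solutions H = (H12, H13, H14, H23, H24, H34) of the Plücker relation, the three subperiod equations, and the coincidence equation is finite. Then there exists a nonzero real λ such that λ·G_ij ∈ ℚ for all 1 ≤ i < j ≤ 4; in particular E contains a nonzero vector with all coordinates rational, so E is not irrational. (Hence no irrational nondegenerate plane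 admits such a configuration: if the plane has no subperiod of type 4, the subcases are all excluded.) -/
/-- A real number killed by every `ℚ`-linear functional on `ℝ` vanishing at `1` is rational. -/
theorem exists_rat_eq_of_forall_dual {θ : ℝ}
    (h : ∀ φ : ℝ →ₗ[ℚ] ℚ, φ 1 = 0 → φ θ = 0) : ∃ m : ℚ, θ = m := by
  by_contra! hθ
  have hmem : θ ∉ Submodule.span ℚ {(1 : ℝ)} := by
    rw [Submodule.mem_span_singleton]
    rintro ⟨m, hm⟩
    exact hθ m (by rw [← hm, Rat.smul_def, mul_one])
  obtain ⟨φ, hφ, hle⟩ := Submodule.exists_le_ker_of_notMem hmem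
  exact hφ (h φ (hle (Submodule.mem_span_singleton_self 1)))

/-- Along a line `n ↦ (Y + n Y', Z + n Z', s + n s', t + n t', w + n w')` the vectors of
Grassmann type with these normalized torus coordinates span infinitely many lines, unless the
direction is zero. -/
theorem direction_eq_zero_of_finite {S : Set (Submodule ℝ (Fin 6 → ℝ))} (hS : S.Finite)
    {Y Z s t w Y' Z' s' t' w' : ℝ} (hY : Y ≠ 0) (hZ : Z ≠ 0)
    (hmem : ∀ n : ℝ, Y + n * Y' ≠ 0 → Z + n * Z' ≠ 0 →
      Submodule.span ℝ {![(s + n * s') / (Y + n * Y'), (t + n * t') / (Z + n * Z'), 1,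
        (w + n * w') / ((Y + n * Y') * (Z + n * Z')), 1 / (Y + n * Y'),
        1 / (Z + n * Z')]} ∈ S) :
    Y' = 0 ∧ Z' = 0 ∧ s' = 0 ∧ t' = 0 ∧ w' = 0 := by
  have finite_zeros : ∀ A B : ℝ, A ≠ 0 → {n : ℝ | A + n * B = 0}.Finite := by
    intro A B hA
    refine (Set.finite_singleton (-A / B)).subset fun n (hn : A + n * B = 0) => ?_
    have hB : B ≠ 0 := by
      rintro rfl
      simp [hA] at hn
    rw [Set.mem_singleton_iff, eq_div_iff hB]
    linarith
  have hinf : ({n : ℝ | Y + n * Y' = 0} ∪ {n : ℝ | Z + n * Z' = 0})ᶜ.Infinite :=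
    ((finite_zeros Y Y' hY).union (finite_zeros Z Z' hZ)).infinite_compl
  have hmaps := fun n (hn : n ∈ ({n : ℝ | Y + n * Y' = 0} ∪ {n : ℝ | Z + n * Z' = 0})ᶜ) =>
    hmem n (fun h => hn (Or.inl h)) (fun h => hn (Or.inr h))
  obtain ⟨n, hn, m, hm, hnm, hspan⟩ := hinf.exists_ne_map_eq_of_mapsTo hmaps hS
  have hYn : Y + n * Y' ≠ 0 := fun h => hn (Or.inl h)
  have hZn : Z + n * Z' ≠ 0 := fun h => hn (Or.inr h)
  have hYm : Y + m * Y' ≠ 0 := fun h => hm (Or.inl h)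
  have hZm : Z + m * Z' ≠ 0 := fun h => hm (Or.inr h)
  obtain ⟨κ, hκ⟩ := Submodule.mem_span_singleton.1
    (hspan ▸ Submodule.mem_span_singleton_self _)
  have h2 := congrFun hκ 2
  simp at h2
  subst h2
  rw [one_smul] at hκ
  have hY0 : Y' = 0 := by
    have h := congrFun hκ 4
    simp at h
    exact h.resolve_left hnm.symm
  have hZ0 : Z' = 0 := by
    have h := congrFun hκ 5
    simp at h
    exact h.resolve_left hnm.symm
  subst hY0 hZ0
  refine ⟨rfl, rfl, ?_, ?_, ?_⟩
  · have h := congrFun hκ 0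
    simp [div_left_inj' hY] at h
    grind
  · have h := congrFun hκ 1
    simp [div_left_inj' hZ] at h
    grind
  · have h := congrFun hκ 3
    simp [div_left_inj' (mul_ne_zero hY hZ)] at h
    grind


/-- case B of Lemma "fourth subperiod": a nondegenerate plane
`span{u, v}` with subperiods of types 1, 3, 2 (and none of type 4 being needed),
a coincidence equation, and a finite projective solution set of the whole system
has Grassmann coordinates proportional to rationals; in particular it contains a
nonzero rational vector, so it is not irrational. (Coordinates of `H ∈ ℝ⁶`
ordered as `H12, H13, H14, H23, H24, H34`; indices: `G12 = G 0 1`,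
`G13 = G 0 2`, `G14 = G 0 3`, `G23 = G 1 2`, `G24 = G 1 3`, `G34 = G 2 3`.) -/
theorem stmt_12 (u v : Fin 4 → ℝ)
    (hindep : LinearIndependent ℝ ![u, v])
    (G : Fin 4 → Fin 4 → ℝ)
    (hG : ∀ i j, G i j = u i * v j - u j * v i)
    (hnondeg : G 0 1 ≠ 0 ∧ G 0 2 ≠ 0 ∧ G 0 3 ≠ 0 ∧ G 1 2 ≠ 0 ∧ G 1 3 ≠ 0 ∧ G 2 3 ≠ 0)
    (p a b q c d r e f : ℚ)
    (hpne : (p, a, b) ≠ (0, 0, 0)) (hqne : (q, c, d) ≠ (0, 0, 0))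
    (hrne : (r, e, f) ≠ (0, 0, 0))
    (hsp1 : (p : ℝ) * G 1 2 = (a : ℝ) * G 1 3 + (b : ℝ) * G 2 3)
    (hsp3 : (q : ℝ) * G 0 1 = (c : ℝ) * G 0 3 + (d : ℝ) * G 1 3)
    (hsp2 : (r : ℝ) * G 0 2 = (e : ℝ) * G 0 3 + (f : ℝ) * G 2 3)
    (k₁ k₂ k₃ k₄ k₅ : ℤ)
    (hco : (k₁ : ℝ) * G 0 1 * G 2 3 + (k₂ : ℝ) * G 0 2 * G 1 3 + (k₃ : ℝ) * G 0 3 * G 1 3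
      + (k₄ : ℝ) * G 0 3 * G 2 3 + (k₅ : ℝ) * G 1 3 * G 2 3 = 0)
    (hfin : Set.Finite {L : Submodule ℝ (Fin 6 → ℝ) | ∃ H : Fin 6 → ℝ, H ≠ 0 ∧
      L = Submodule.span ℝ {H} ∧
      H 0 * H 5 = H 1 * H 4 - H 2 * H 3 ∧
      (p : ℝ) * H 3 = (a : ℝ) * H 4 + (b : ℝ) * H 5 ∧
      (q : ℝ) * H 0 = (c : ℝ) * H 2 + (d : ℝ) * H 4 ∧
      (r : ℝ) * H 1 = (e : ℝ) * H 2 + (f : ℝ) * H 5 ∧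
      (k₁ : ℝ) * H 0 * H 5 + (k₂ : ℝ) * H 1 * H 4 + (k₃ : ℝ) * H 2 * H 4
        + (k₄ : ℝ) * H 2 * H 5 + (k₅ : ℝ) * H 4 * H 5 = 0}) :
    (∃ lam : ℝ, lam ≠ 0 ∧ ∀ i j : Fin 4, i < j → ∃ m : ℚ, lam * G i j = (m : ℝ)) ∧
    (∃ w : Fin 4 → ℝ, w ∈ Submodule.span ℝ ({u, v} : Set (Fin 4 → ℝ)) ∧ w ≠ 0 ∧
      ∀ i, ∃ m : ℚ, w i = (m : ℝ)) := by

  obtain ⟨h01, h02, h03, h12, h13, h23⟩ := hnondeg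
  have hplu : G 0 1 * G 2 3 = G 0 2 * G 1 3 - G 0 3 * G 1 2 := by
    simp only [hG]
    ring
  obtain ⟨Y, hYdef⟩ : ∃ Y, Y = G 0 3 / G 1 3 := ⟨_, rfl⟩
  obtain ⟨Z, hZdef⟩ : ∃ Z, Z = G 0 3 / G 2 3 := ⟨_, rfl⟩
  obtain ⟨s, hsdef⟩ : ∃ s, s = G 0 1 / G 1 3 := ⟨_, rfl⟩
  obtain ⟨t, htdef⟩ : ∃ t, t = G 0 2 / G 2 3 := ⟨_, rfl⟩
  obtain ⟨w, hwdef⟩ : ∃ w, w = G 0 3 * G 1 2 / (G 1 3 * G 2 3) := ⟨_, rfl⟩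
  have hY : Y ≠ 0 := hYdef ▸ div_ne_zero h03 h13
  have hZ : Z ≠ 0 := hZdef ▸ div_ne_zero h03 h23
  have e0 : s = t - w := by
    rw [hsdef, htdef, hwdef]
    field_simp
    linear_combination hplu
  have e1 : (p : ℝ) * w = a * Z + b * Y := by
    rw [hYdef, hZdef, hwdef]
    field_simp
    linear_combination hsp1
  have e3 : (q : ℝ) * s = c * Y + d * 1 := by
    rw [hYdef, hsdef]
    field_simp
    linear_combination hsp3
  have e2 : (r : ℝ) * t = e * Z + f * 1 := by
    rw [hZdef, htdef]
    field_simp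
    linear_combination hsp2
  have ec : ((k₁ : ℚ) : ℝ) * s + ((k₂ : ℚ) : ℝ) * t + ((k₃ : ℚ) : ℝ) * Z
      + ((k₄ : ℚ) : ℝ) * Y + ((k₅ : ℚ) : ℝ) * 1 = 0 := by
    rw [hYdef, hZdef, hsdef, htdef]
    push_cast
    field_simp
    linear_combination hco
  have key : ∀ φ : ℝ →ₗ[ℚ] ℚ, φ 1 = 0 → φ Y = 0 ∧ φ Z = 0 ∧ φ s = 0 ∧ φ t = 0 ∧ φ w = 0 := by
    intro φ h1
    have hmul : ∀ (x : ℚ) (y : ℝ), φ (x * y) = x * φ y := fun x y => by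
      rw [← Rat.smul_def, map_smul, smul_eq_mul]
    have f0 : (φ s : ℝ) = φ t - φ w := by
      rw [e0, map_sub]
      push_cast
      rfl
    have f1 := congrArg φ e1
    have f3 := congrArg φ e3
    have f2 := congrArg φ e2
    have fc := congrArg φ ec
    simp only [map_add, hmul, h1, mul_zero, add_zero, map_zero] at f1 f2 f3 fc
    replace f1 : (p : ℝ) * φ w = a * φ Z + b * φ Y := by exact_mod_cast f1
    replace f3 : (q : ℝ) * φ s = c * φ Y := by exact_mod_cast f3
    replace f2 : (r : ℝ) * φ t = e * φ Z := by exact_mod_cast f2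
    replace fc : (k₁ : ℝ) * φ s + k₂ * φ t + k₃ * φ Z + k₄ * φ Y = 0 := by exact_mod_cast fc
    push_cast at ec
    have hdir := direction_eq_zero_of_finite (s := s) (t := t) (w := w) (Y' := φ Y) (Z' := φ Z)
      (s' := φ s) (t' := φ t) (w' := φ w) hfin hY hZ ?_
    · exact_mod_cast hdir
    intro n hYn hZn
    refine ⟨_, fun h => one_ne_zero (congrFun h 2), rfl, ?_⟩
    simp only [Matrix.cons_val]
    refine ⟨?_, ?_, ?_, ?_, ?_⟩ <;> field_simp
    · linear_combination e0 + n * f0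
    · linear_combination e1 + n * f1
    · linear_combination e3 + n * f3
    · linear_combination e2 + n * f2
    · linear_combination ec + n * fc
  obtain ⟨mY, hmY⟩ := exists_rat_eq_of_forall_dual fun φ h => (key φ h).1
  obtain ⟨mZ, hmZ⟩ := exists_rat_eq_of_forall_dual fun φ h => (key φ h).2.1
  obtain ⟨ms, hms⟩ := exists_rat_eq_of_forall_dual fun φ h => (key φ h).2.2.1
  obtain ⟨mt, hmt⟩ := exists_rat_eq_of_forall_dual fun φ h => (key φ h).2.2.2.1
  obtain ⟨mw, hmw⟩ := exists_rat_eq_of_forall_dual fun φ h => (key φ h).2.2.2.2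
  have r01 : (G 0 3)⁻¹ * G 0 1 = (ms / mY : ℚ) := by
    rw [Rat.cast_div, ← hms, ← hmY, hsdef, hYdef]
    field_simp
  have r02 : (G 0 3)⁻¹ * G 0 2 = (mt / mZ : ℚ) := by
    rw [Rat.cast_div, ← hmt, ← hmZ, htdef, hZdef]
    field_simp
  have r03 : (G 0 3)⁻¹ * G 0 3 = (1 : ℚ) := by
    rw [inv_mul_cancel₀ h03, Rat.cast_one]
  have r12 : (G 0 3)⁻¹ * G 1 2 = (mw / (mY * mZ) : ℚ) := by
    rw [Rat.cast_div, Rat.cast_mul, ← hmw, ← hmY, ← hmZ, hwdef, hYdef, hZdef]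
    field_simp
  have r13 : (G 0 3)⁻¹ * G 1 3 = (1 / mY : ℚ) := by
    rw [Rat.cast_div, ← hmY, hYdef]
    field_simp
    simp
  have r23 : (G 0 3)⁻¹ * G 2 3 = (1 / mZ : ℚ) := by
    rw [Rat.cast_div, ← hmZ, hZdef]
    field_simp
    simp
  refine ⟨⟨(G 0 3)⁻¹, inv_ne_zero h03, ?_⟩, fun i => (G 0 3)⁻¹ * G 0 i, ?_, ?_, ?_⟩
  · intro i j hij
    fin_cases i <;> fin_cases j <;> first
      | exact absurd hij (by decide)
      | exact ⟨_, r01⟩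
      | exact ⟨_, r02⟩
      | exact ⟨_, r03⟩
      | exact ⟨_, r12⟩
      | exact ⟨_, r13⟩
      | exact ⟨_, r23⟩
  · refine Submodule.mem_span_pair.2 ⟨-(G 0 3)⁻¹ * v 0, (G 0 3)⁻¹ * u 0, ?_⟩
    ext i
    simp only [Pi.add_apply, Pi.smul_apply, smul_eq_mul, hG 0 i]
    ring
  · intro h
    exact mul_ne_zero (inv_ne_zero h03) h03 (congrFun h 3)
  · intro i
    fin_cases i
    · exact ⟨0, by simp [hG 0 0, mul_comm]⟩
    · exact ⟨_, r01⟩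
    · exact ⟨_, r02⟩
    · exact ⟨_, r03⟩
end

section
/- Let a₁, b₁, c₁, a₂, b₂, c₂, d₂ ∈ ℚ and let S = {(x, y) ∈ ℝ² : a₁·x·y + b₁·x + c₁·y = 0 and a₂·x·y + b₂·x + c₂·y + d₂ = 0}. If S is finite, then every (x, y) ∈ S generates a field extension ℚ(x, y) of ℚ of degree at most 2; in particular both x and y lie in a common real quadratic number field or in ℚ. -/
open Polynomial in
/-- An element annihilated by a nonzero polynomial of degree at most two generates an extension of
degree at most two. -/
theorem adjoin_pair_finrank_le_two {K L : Type*} [Field K] [Field L] [Algebra K L] {x y : L}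
    {A B C : K} (hne : ¬(A = 0 ∧ B = 0 ∧ C = 0))
    (hx : algebraMap K L A * x ^ 2 + algebraMap K L B * x + algebraMap K L C = 0)
    (hy : y ∈ IntermediateField.adjoin K ({x} : Set L)) :
    FiniteDimensional K (IntermediateField.adjoin K ({x, y} : Set L)) ∧
      Module.finrank K (IntermediateField.adjoin K ({x, y} : Set L)) ≤ 2 := by
  have hadj : IntermediateField.adjoin K ({x, y} : Set L) = IntermediateField.adjoin K {x} := by
    refine le_antisymm (IntermediateField.adjoin_le_iff.2 ?_)
      (IntermediateField.adjoin.mono K _ _ (by simp))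
    rintro z (rfl | rfl)
    · exact IntermediateField.mem_adjoin_simple_self K z
    · exact hy
  rw [hadj]
  set P : K[X] := Polynomial.C A * X ^ 2 + Polynomial.C B * X + Polynomial.C C with hP
  have hP0 : P ≠ 0 := by
    intro h
    refine hne ⟨?_, ?_, ?_⟩
    · simpa [hP, coeff_X, coeff_C] using congrArg (coeff · 2) h
    · simpa [hP, coeff_X, coeff_C] using congrArg (coeff · 1) h
    · simpa [hP] using congrArg (coeff · 0) h
  have hPx : aeval x P = 0 := by simpa [hP] using hx
  have hint : IsIntegral K x := (show IsAlgebraic K x from ⟨P, hP0, hPx⟩).isIntegral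
  refine ⟨IntermediateField.adjoin.finiteDimensional hint, ?_⟩
  rw [IntermediateField.adjoin.finrank hint]
  exact (natDegree_le_of_dvd (minpoly.dvd K x hPx) hP0).trans natDegree_quadratic_le

/-- If two bilinear equations have finitely many common real solutions, then a solution `(x, y)` at
which the first equation determines `y` in terms of `x` generates an extension of degree at most
two. -/
theorem adjoin_finrank_le_two_of_bilinear_system {a₁ b₁ c₁ d₁ a₂ b₂ c₂ d₂ : ℚ}
    (hfin : {w : ℝ × ℝ |
      (a₁ : ℝ) * w.1 * w.2 + (b₁ : ℝ) * w.1 + (c₁ : ℝ) * w.2 + (d₁ : ℝ) = 0 ∧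
      (a₂ : ℝ) * w.1 * w.2 + (b₂ : ℝ) * w.1 + (c₂ : ℝ) * w.2 + (d₂ : ℝ) = 0}.Finite)
    {x y : ℝ} (h₁ : (a₁ : ℝ) * x * y + b₁ * x + c₁ * y + d₁ = 0)
    (h₂ : (a₂ : ℝ) * x * y + b₂ * x + c₂ * y + d₂ = 0) (hx : (a₁ : ℝ) * x + c₁ ≠ 0) :
    FiniteDimensional ℚ (IntermediateField.adjoin ℚ ({x, y} : Set ℝ)) ∧
      Module.finrank ℚ (IntermediateField.adjoin ℚ ({x, y} : Set ℝ)) ≤ 2 := by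
  refine adjoin_pair_finrank_le_two (A := b₁ * a₂ - b₂ * a₁)
    (B := b₁ * c₂ + d₁ * a₂ - b₂ * c₁ - d₂ * a₁) (C := d₁ * c₂ - d₂ * c₁) ?_ ?_ ?_
  · rintro ⟨hA, hB, hC⟩
    have hA' : (b₁ * a₂ - b₂ * a₁ : ℝ) = 0 := by exact_mod_cast hA
    have hB' : (b₁ * c₂ + d₁ * a₂ - b₂ * c₁ - d₂ * a₁ : ℝ) = 0 := by exact_mod_cast hB
    have hC' : (d₁ * c₂ - d₂ * c₁ : ℝ) = 0 := by exact_mod_cast hC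
    have hbad : {t : ℝ | (a₁ : ℝ) * t + c₁ = 0}.Finite := by
      refine (Set.finite_singleton (-(c₁ : ℝ) / a₁)).subset fun t ht => ?_
      have ht : (a₁ : ℝ) * t + c₁ = 0 := ht
      have ha : (a₁ : ℝ) ≠ 0 := by
        intro ha
        simp_all
      rw [Set.mem_singleton_iff, eq_div_iff ha]
      linarith
    refine hbad.infinite_compl ((hfin.image Prod.fst).subset fun t ht => ?_)
    have ht : (a₁ : ℝ) * t + c₁ ≠ 0 := ht
    obtain ⟨u, hu⟩ : ∃ u : ℝ, u * (a₁ * t + c₁) = -(b₁ * t + d₁) :=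
      ⟨_, div_mul_cancel₀ _ ht⟩
    refine ⟨(t, u), ⟨?_, mul_left_cancel₀ ht ?_⟩, rfl⟩
    · dsimp only
      linear_combination hu
    · dsimp only
      linear_combination (a₂ * t + c₂) * hu - (t ^ 2 * hA' + t * hB' + hC')
  · simp only [eq_ratCast]
    push_cast
    linear_combination (a₂ * x + c₂) * h₁ - (a₁ * x + c₁) * h₂
  · have hy : y = -(b₁ * x + d₁) / (a₁ * x + c₁) := by
      rw [eq_div_iff hx]
      linear_combination h₁
    have hmem := IntermediateField.mem_adjoin_simple_self ℚ x
    have hrat (q : ℚ) : (q : ℝ) ∈ IntermediateField.adjoin ℚ ({x} : Set ℝ) :=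
      SubfieldClass.ratCast_mem _ q
    rw [hy]
    exact div_mem (neg_mem (add_mem (mul_mem (hrat _) hmem) (hrat _)))
      (add_mem (mul_mem (hrat _) hmem) (hrat _))


/-- algebraic core of the quadraticity argument: if the real
solution set of the system `a₁xy + b₁x + c₁y = 0`, `a₂xy + b₂x + c₂y + d₂ = 0`
with rational coefficients is finite, then each solution `(x, y)` generates a
field extension `ℚ(x, y)` of `ℚ` of degree at most 2. -/
theorem stmt_13 (a₁ b₁ c₁ a₂ b₂ c₂ d₂ : ℚ) (S : Set (ℝ × ℝ))
    (hS : S = {w : ℝ × ℝ |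
      (a₁ : ℝ) * w.1 * w.2 + (b₁ : ℝ) * w.1 + (c₁ : ℝ) * w.2 = 0 ∧
      (a₂ : ℝ) * w.1 * w.2 + (b₂ : ℝ) * w.1 + (c₂ : ℝ) * w.2 + (d₂ : ℝ) = 0})
    (hfin : S.Finite) :
    ∀ x y : ℝ, (x, y) ∈ S →
      FiniteDimensional ℚ (IntermediateField.adjoin ℚ ({x, y} : Set ℝ)) ∧
      Module.finrank ℚ (IntermediateField.adjoin ℚ ({x, y} : Set ℝ)) ≤ 2 := by
  subst hS
  rintro x y ⟨h₁, h₂⟩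
  dsimp only at h₁ h₂
  by_cases hx₁ : (a₁ : ℝ) * x + c₁ = 0
  · by_cases hx₂ : (a₂ : ℝ) * x + c₂ = 0
    · refine (Set.infinite_univ (α := ℝ) ((hfin.image Prod.snd).subset fun t _ => ?_)).elim
      refine ⟨(x, t), ⟨?_, ?_⟩, rfl⟩
      · dsimp only
        linear_combination h₁ + (t - y) * hx₁
      · dsimp only
        linear_combination h₂ + (t - y) * hx₂
    · refine adjoin_finrank_le_two_of_bilinear_system (a₂ := a₁) (b₂ := b₁) (c₂ := c₁) (d₂ := 0)
        (hfin.subset ?_) h₂ (by simpa using h₁) hx₂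
      rintro w ⟨hw₂, hw₁⟩
      exact ⟨by simpa using hw₁, hw₂⟩
  · refine adjoin_finrank_le_two_of_bilinear_system (d₁ := 0)
      (hfin.subset ?_) (by simpa using h₁) h₂ hx₁
    rintro w ⟨hw₁, hw₂⟩
    exact ⟨by simpa using hw₁, hw₂⟩
end

section
/- Let a₁, b₁, c₁, a₂, b₂, c₂ ∈ ℚ and let S = {(x, y) ∈ ℝ² : a₁·x·y + b₁·x + c₁·y = 0 and a₂·x·y + b₂·x + c₂·y = 0}. If S is finite, then every (x, y) ∈ S has both coordinates rational: x ∈ ℚ and y ∈ ℚ. -/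
/-- Two proportional linear forms in two variables have a common nontrivial zero. -/
theorem exists_common_zero_of_det_eq_zero {K : Type*} [Field K] (b₁ c₁ b₂ c₂ : K)
    (hD : b₁ * c₂ = c₁ * b₂) :
    ∃ s t : K, (s ≠ 0 ∨ t ≠ 0) ∧ c₁ * s + b₁ * t = 0 ∧ c₂ * s + b₂ * t = 0 := by
  by_cases h₁ : b₁ ≠ 0 ∨ c₁ ≠ 0
  · refine ⟨b₁, -c₁, by simpa using h₁, by ring, by linear_combination hD⟩
  by_cases h₂ : b₂ ≠ 0 ∨ c₂ ≠ 0
  · refine ⟨b₂, -c₂, by simpa using h₂, by linear_combination -hD, by ring⟩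
  push Not at h₁ h₂
  exact ⟨1, 0, by simp, by simp [h₁], by simp [h₂]⟩

/-- If the linear parts of two bilinear equations without constant term are proportional, then
the existence of a common zero off the coordinate axes forces infinitely many common zeros. -/
theorem infinite_bilinear_zeros {K : Type*} [Field K] [Infinite K] (a₁ b₁ c₁ a₂ b₂ c₂ : K)
    (hD : b₁ * c₂ = c₁ * b₂) {x y : K} (hx : x ≠ 0) (hy : y ≠ 0)
    (h₁ : a₁ * x * y + b₁ * x + c₁ * y = 0) (h₂ : a₂ * x * y + b₂ * x + c₂ * y = 0) :
    {w : K × K | a₁ * w.1 * w.2 + b₁ * w.1 + c₁ * w.2 = 0 ∧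
      a₂ * w.1 * w.2 + b₂ * w.1 + c₂ * w.2 = 0}.Infinite := by
  obtain ⟨s, t, hst, e₁, e₂⟩ := exists_common_zero_of_det_eq_zero b₁ c₁ b₂ c₂ hD
  have line_zero (a b c r : K) (h : a * x * y + b * x + c * y = 0) (e : c * s + b * t = 0)
      (hu : x⁻¹ + r * s ≠ 0) (hv : y⁻¹ + r * t ≠ 0) :
      a * (x⁻¹ + r * s)⁻¹ * (y⁻¹ + r * t)⁻¹ + b * (x⁻¹ + r * s)⁻¹ + c * (y⁻¹ + r * t)⁻¹ = 0 := by
    have h' : a + b * y⁻¹ + c * x⁻¹ = 0 := by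
      field_simp
      linear_combination h
    generalize x⁻¹ = u at *
    generalize y⁻¹ = v at *
    field_simp
    linear_combination h' + r * e
  refine Set.infinite_of_injOn_mapsTo (s := Set.univ \ {-x⁻¹ / s, -y⁻¹ / t})
    (f := fun r => ((x⁻¹ + r * s)⁻¹, (y⁻¹ + r * t)⁻¹)) ?_ ?_
    (Set.infinite_univ.sdiff (Set.toFinite _))
  · intro r _ r' _ h
    simp only [Prod.mk.injEq, inv_inj, add_right_inj] at h
    rcases hst with hs | ht
    · exact mul_right_cancel₀ hs h.1
    · exact mul_right_cancel₀ ht h.2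
  · intro r hr
    have denom_ne {z p : K} (hz : z ≠ 0) (hp : r ≠ -z⁻¹ / p) : z⁻¹ + r * p ≠ 0 := by
      intro h
      by_cases hp0 : p = 0
      · simp [hp0, hz] at h
      · exact hp (by rw [eq_div_iff hp0]; linear_combination h)
    simp only [Set.mem_sdiff, Set.mem_univ, Set.mem_insert_iff, Set.mem_singleton_iff, true_and,
      not_or] at hr
    have hu := denom_ne hx hr.1
    have hv := denom_ne hy hr.2
    exact ⟨line_zero _ _ _ _ h₁ e₁ hu hv, line_zero _ _ _ _ h₂ e₂ hu hv⟩

/-- algebraic core of the rationality argument excluding case B: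
if the real solution set of the system `a₁xy + b₁x + c₁y = 0`,
`a₂xy + b₂x + c₂y = 0` with rational coefficients is finite, then each solution
has both coordinates rational. -/
theorem stmt_14 (a₁ b₁ c₁ a₂ b₂ c₂ : ℚ) (S : Set (ℝ × ℝ))
    (hS : S = {w : ℝ × ℝ |
      (a₁ : ℝ) * w.1 * w.2 + (b₁ : ℝ) * w.1 + (c₁ : ℝ) * w.2 = 0 ∧
      (a₂ : ℝ) * w.1 * w.2 + (b₂ : ℝ) * w.1 + (c₂ : ℝ) * w.2 = 0})
    (hfin : S.Finite) :
    ∀ x y : ℝ, (x, y) ∈ S → (∃ qx : ℚ, x = (qx : ℝ)) ∧ (∃ qy : ℚ, y = (qy : ℝ)) := by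
  subst hS
  rintro x y ⟨h₁, h₂⟩
  dsimp only at h₁ h₂
  rcases eq_or_ne x 0 with rfl | hx
  · rcases eq_or_ne y 0 with rfl | hy
    · exact ⟨⟨0, by simp⟩, ⟨0, by simp⟩⟩
    · simp only [mul_zero, zero_mul, zero_add, mul_eq_zero, hy, or_false] at h₁ h₂
      refine absurd hfin (Set.infinite_of_injective_forall_mem (f := fun r : ℝ => ((0 : ℝ), r))
        (fun r r' h => by simpa using h) fun r => ?_)
      simp [h₁, h₂]
  rcases eq_or_ne y 0 with rfl | hy
  · simp only [mul_zero, add_zero, zero_add, mul_eq_zero, hx, or_false] at h₁ h₂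
    refine absurd hfin (Set.infinite_of_injective_forall_mem (f := fun r : ℝ => (r, (0 : ℝ)))
      (fun r r' h => by simpa using h) fun r => ?_)
    simp [h₁, h₂]
  have hD : (b₁ * c₂ - c₁ * b₂ : ℝ) ≠ 0 := fun hD =>
    infinite_bilinear_zeros _ _ _ _ _ _ (sub_eq_zero.mp hD) hx hy h₁ h₂ hfin
  have ex : (a₂ * b₁ - a₁ * b₂ : ℝ) * x = -(b₁ * c₂ - c₁ * b₂) :=
    mul_right_cancel₀ hy (by linear_combination b₁ * h₂ - b₂ * h₁)
  have ey : (a₁ * c₂ - a₂ * c₁ : ℝ) * y = -(b₁ * c₂ - c₁ * b₂) :=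
    mul_right_cancel₀ hx (by linear_combination c₂ * h₁ - c₁ * h₂)
  have hx' : (a₂ * b₁ - a₁ * b₂ : ℝ) ≠ 0 := left_ne_zero_of_mul (ex ▸ neg_ne_zero.mpr hD)
  have hy' : (a₁ * c₂ - a₂ * c₁ : ℝ) ≠ 0 := left_ne_zero_of_mul (ey ▸ neg_ne_zero.mpr hD)
  refine ⟨⟨-(b₁ * c₂ - c₁ * b₂) / (a₂ * b₁ - a₁ * b₂), ?_⟩,
    ⟨-(b₁ * c₂ - c₁ * b₂) / (a₁ * c₂ - a₂ * c₁), ?_⟩⟩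
  · push_cast
    rw [eq_div_iff hx', mul_comm, ex]
  · push_cast
    rw [eq_div_iff hy', mul_comm, ey]
end
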